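/- Let Δ be the independence complex of a simple graph G that is either a cactus graph, a bipartite graph, or a chordal graph. Then I_Δ^∨ (= J(G)) is weakly polymatroidal in some ordering of the variables if and only if Δ is vertex decomposable and pure. -/

import Mathlib

/-!
STATEMENT 11: Let `Δ` be the independence complex of a simple graph `G` which is a cactus
graph, a bipartite graph, or a chordal graph.  Then `I_Δ^∨` (= `J(G)`) is weakly
polymatroidal in some ordering of the variables if and only if `Δ` is vertex
decomposable and pure.
-/

open MvPolynomial

namespace Stmt

variable (K : Type) [Field K]

/-- `F` is a vertex cover of the graph `G`. -/
def IsVertexCover {V : Type} (G : SimpleGraph V) (F : Finset V) : Prop :=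
  ∀ v w, G.Adj v w → v ∈ F ∨ w ∈ F

/-- `F` is a minimal vertex cover of the graph `G`. -/
def IsMinimalVertexCover {V : Type} (G : SimpleGraph V) (F : Finset V) : Prop :=
  IsVertexCover G F ∧ ∀ F' ⊆ F, IsVertexCover G F' → F' = F

/-- The vertex cover ideal `J(G)`, generated by the monomials `∏_{v ∈ F} x_v`
with `F` a minimal vertex cover of `G`. -/
noncomputable def coverIdeal {V : Type} (G : SimpleGraph V) : Ideal (MvPolynomial V K) :=
  Ideal.span { m | ∃ F : Finset V, IsMinimalVertexCover G F ∧ m = ∏ v ∈ F, X v }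

/-- The `s`-th symbolic power `J(G)^{(s)} = ⋂_{{v,w} ∈ E(G)} (x_v, x_w)^s`. -/
noncomputable def symbolicCoverPower {V : Type} (G : SimpleGraph V) (s : ℕ) :
    Ideal (MvPolynomial V K) :=
  ⨅ (v : V) (w : V) (_ : G.Adj v w), (Ideal.span {X v, X w} : Ideal (MvPolynomial V K)) ^ s

/-- `a` is the exponent vector of an element of the minimal monomial generating set `G(I)`
of the monomial ideal `I`: the monomial `x^a` lies in `I` and no proper monomial divisor
of it lies in `I`. -/
def IsMonoMinGen {τ : Type} (I : Ideal (MvPolynomial τ K)) (a : τ →₀ ℕ) : Prop :=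
  (monomial a (1 : K)) ∈ I ∧
    ∀ b : τ →₀ ℕ, (monomial b (1 : K)) ∈ I → b ≤ a → b = a

/-- A monomial ideal `I` (not necessarily generated in one degree) is weakly polymatroidal
with respect to a strict order `lt` on the variables (where `lt p q` means that the
variable `x_p` precedes, i.e. is greater than, the variable `x_q`):  for all exponent
vectors `a b` of minimal monomial generators `u = x^a`, `v = x^b` of `I`, if `a` and `b`
agree on all variables preceding `q` and `a q < b q`, then there is a variable `p`
coming after `q` such that `x_q · u / x_p` is again a minimal monomial generator. -/
def WeaklyPolymatroidalWrt {τ : Type} [DecidableEq τ] (lt : τ → τ → Prop)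
    (I : Ideal (MvPolynomial τ K)) : Prop :=
  ∀ a b : τ →₀ ℕ, IsMonoMinGen K I a → IsMonoMinGen K I b →
    ∀ q : τ, (∀ p, lt p q → a p = b p) → a q < b q →
      ∃ p, lt q p ∧ 0 < a p ∧
        IsMonoMinGen K I (a + Finsupp.single q 1 - Finsupp.single p 1)

/-- The collection `Δ` of finite subsets of `V` is (the set of faces of) a simplicial
complex: it is closed under passing to subsets. -/
def IsSimplicialComplex {V : Type} (Δ : Finset V → Prop) : Prop :=
  ∀ F G : Finset V, Δ F → G ⊆ F → Δ G

/-- `F` is a facet (maximal face) of `Δ`. -/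
def IsFacet {V : Type} (Δ : Finset V → Prop) (F : Finset V) : Prop :=
  Δ F ∧ ∀ G, Δ G → F ⊆ G → F = G

/-- The link of the vertex `x` in `Δ`. -/
def cplxLink {V : Type} [DecidableEq V] (Δ : Finset V → Prop) (x : V) :
    Finset V → Prop :=
  fun F => x ∉ F ∧ Δ (insert x F)

/-- The deletion of the vertex `x` from `Δ`. -/
def cplxDel {V : Type} (Δ : Finset V → Prop) (x : V) : Finset V → Prop :=
  fun F => x ∉ F ∧ Δ F

/-- Vertex decomposability of a simplicial complex: either `Δ` is a simplex, or it has a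
shedding vertex `x` whose link and deletion are both vertex decomposable. -/
inductive VertexDecomposable {V : Type} [DecidableEq V] : (Finset V → Prop) → Prop
  | simplex (Δ : Finset V → Prop) (F : Finset V) (h : ∀ G, Δ G ↔ G ⊆ F) :
      VertexDecomposable Δ
  | shed (Δ : Finset V → Prop) (x : V) (hx : Δ {x})
      (hlink : VertexDecomposable (cplxLink Δ x))
      (hdel : VertexDecomposable (cplxDel Δ x))
      (hshed : ∀ F, IsFacet (cplxLink Δ x) F → ¬ IsFacet (cplxDel Δ x) F) :
      VertexDecomposable Δ

/-- The Alexander dual ideal of `Δ`, with `Δ` regarded as a complex on the vertex set `W`: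
it is generated by the monomials `∏_{v ∈ W \ F} x_v` with `F` a facet of `Δ`. -/
noncomputable def dualIdealIn {V : Type} [DecidableEq V] (W : Finset V)
    (Δ : Finset V → Prop) : Ideal (MvPolynomial V K) :=
  Ideal.span { m | ∃ F, IsFacet Δ F ∧ m = ∏ v ∈ W \ F, X v }

/-- The Alexander dual ideal `I_Δ^∨` of the Stanley–Reisner ideal of `Δ`. -/
noncomputable def dualIdeal {V : Type} [Fintype V] [DecidableEq V]
    (Δ : Finset V → Prop) : Ideal (MvPolynomial V K) :=
  dualIdealIn K Finset.univ Δ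

/-- `G` is unmixed: all minimal vertex covers have the same cardinality. -/
def IsUnmixed {V : Type} (G : SimpleGraph V) : Prop :=
  ∀ F F' : Finset V, IsMinimalVertexCover G F → IsMinimalVertexCover G F' →
    F.card = F'.card

/-- A subgraph of `G` which is a cycle: it is connected and every one of its vertices has
exactly two neighbours in it. -/
def IsCycleSubgraph {V : Type} (G : SimpleGraph V) (H : G.Subgraph) : Prop :=
  H.Connected ∧ ∀ v ∈ H.verts, (H.neighborSet v).ncard = 2

/-- `G` is a cactus graph: every edge of `G` belongs to at most one cycle. -/
def IsCactus {V : Type} (G : SimpleGraph V) : Prop :=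
  ∀ C₁ C₂ : G.Subgraph, IsCycleSubgraph G C₁ → IsCycleSubgraph G C₂ →
    ∀ e ∈ C₁.edgeSet, e ∈ C₂.edgeSet → C₁ = C₂

/-- `G` is chordal: every cycle of length at least 4 has a chord. -/
def IsChordal {V : Type} (G : SimpleGraph V) : Prop :=
  ∀ (v : V) (c : G.Walk v v), c.IsCycle → 4 ≤ c.length →
    ∃ a b, a ∈ c.support ∧ b ∈ c.support ∧ G.Adj a b ∧ s(a, b) ∉ c.edges

/-- The independence complex of `G`: faces are the independent sets of `G`. -/
def indepCpx {V : Type} (G : SimpleGraph V) : Finset V → Prop :=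
  fun F => ∀ v ∈ F, ∀ w ∈ F, ¬ G.Adj v w

/-- The edge ideal `I(G)`, generated by the monomials `x_v x_w` over edges `{v,w}`. -/
noncomputable def edgeIdeal {V : Type} (G : SimpleGraph V) : Ideal (MvPolynomial V K) :=
  Ideal.span { m | ∃ v w, G.Adj v w ∧ m = X v * X w }

/-- `R ⧸ I` is a Cohen–Macaulay ring, expressed (for a graded quotient of a polynomial
ring) by the existence of a regular sequence inside the graded maximal ideal
`m = (x_v : v)` whose length equals the Krull dimension of `R ⧸ I`
(i.e. `depth_m (R ⧸ I) = dim (R ⧸ I)`). -/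
def IsCohenMacaulayQuot {τ : Type} (I : Ideal (MvPolynomial τ K)) : Prop :=
  ∃ rs : List (MvPolynomial τ K),
    (∀ r ∈ rs, r ∈ Ideal.span (Set.range (X : τ → MvPolynomial τ K))) ∧
    RingTheory.Sequence.IsRegular (MvPolynomial τ K ⧸ I) rs ∧
    ((rs.length : WithTop ℕ) : WithBot (WithTop ℕ)) = ringKrullDim (MvPolynomial τ K ⧸ I)

/-- `Δ` is pure: all its facets have the same cardinality. -/
def IsPure {V : Type} (Δ : Finset V → Prop) : Prop :=
  ∀ F G : Finset V, IsFacet Δ F → IsFacet Δ G → F.card = G.card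

section Facets

variable {V : Type} [Fintype V]

lemma exists_facet_of_face {Δ : Finset V → Prop} {F : Finset V} (h : Δ F) :
    ∃ F', IsFacet Δ F' ∧ F ⊆ F' := by
  obtain ⟨M, hFM, hM⟩ := (Set.toFinite {F | Δ F}).exists_le_maximal h
  exact ⟨M, ⟨hM.prop, fun G hG hMG => hMG.antisymm (hM.le_of_ge hG hMG)⟩, hFM⟩

lemma isFacet_of_card_eq {Δ : Finset V → Prop} (hpure : IsPure Δ) {F A : Finset V}
    (hF : Δ F) (hA : IsFacet Δ A) (hcard : F.card = A.card) : IsFacet Δ F := by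
  obtain ⟨M, hM, hFM⟩ := exists_facet_of_face hF
  have := hpure M A hM hA
  rwa [Finset.eq_of_subset_of_card_le hFM (by omega)]

variable [DecidableEq V]

/-- The exponent vector of the squarefree monomial supported on the complement of `F`. -/
noncomputable def complExponent (F : Finset V) : V →₀ ℕ :=
  ∑ v ∈ Finset.univ \ F, Finsupp.single v 1

lemma complExponent_apply (F : Finset V) (v : V) :
    complExponent F v = if v ∈ F then 0 else 1 := by
  simp [complExponent, Finsupp.finsetSum_apply, Finsupp.single_apply]

lemma complExponent_le_iff {F F' : Finset V} :
    complExponent F ≤ complExponent F' ↔ F' ⊆ F := by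
  constructor
  · intro h v hv
    have := h v
    simp only [complExponent_apply, hv, if_true] at this
    by_contra hv'
    simp [hv'] at this
  · intro h v
    simp only [complExponent_apply]
    by_cases hv : v ∈ F'
    · simp [hv, h hv]
    · simp only [hv, if_false]
      split_ifs <;> omega

lemma monomial_mem_dualIdeal_iff {Δ : Finset V → Prop} {a : V →₀ ℕ} :
    monomial a (1 : K) ∈ dualIdeal K Δ ↔ ∃ F, IsFacet Δ F ∧ complExponent F ≤ a := by
  have hset : { m : MvPolynomial V K | ∃ F, IsFacet Δ F ∧ m = ∏ v ∈ Finset.univ \ F, X v } =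
      Set.image (fun s => monomial s (1 : K)) (Set.image complExponent {F | IsFacet Δ F}) := by
    ext m
    simp only [Set.mem_ofPred_eq, Set.mem_image, exists_exists_and_eq_and]
    refine exists_congr fun F => and_congr_right fun _ => ?_
    rw [complExponent, monomial_sum_one, eq_comm]
    rfl
  rw [dualIdeal, dualIdealIn, hset, mem_ideal_span_monomial_image]
  simp

lemma isMonoMinGen_dualIdeal_iff {Δ : Finset V → Prop} {a : V →₀ ℕ} :
    IsMonoMinGen K (dualIdeal K Δ) a ↔ ∃ F, IsFacet Δ F ∧ a = complExponent F := by
  simp only [IsMonoMinGen, monomial_mem_dualIdeal_iff]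
  constructor
  · rintro ⟨⟨F, hF, hFa⟩, hmin⟩
    exact ⟨F, hF, (hmin _ ⟨F, hF, le_rfl⟩ hFa).symm⟩
  · rintro ⟨F, hF, rfl⟩
    refine ⟨⟨F, hF, le_rfl⟩, ?_⟩
    rintro b ⟨F', hF', hb⟩ hbF
    have := hF.2 F' hF'.1 (complExponent_le_iff.1 (hb.trans hbF))
    subst this
    exact le_antisymm hbF hb

/-- The facets of `Δ` satisfy the exchange property dual to weak polymatroidality. -/
def FacetExchange (lt : V → V → Prop) (Δ : Finset V → Prop) : Prop :=
  ∀ A B : Finset V, IsFacet Δ A → IsFacet Δ B → ∀ q, (∀ p, lt p q → (p ∈ A ↔ p ∈ B)) →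
    q ∈ A → q ∉ B → ∃ p, lt q p ∧ p ∉ A ∧ IsFacet Δ (insert p (A.erase q))

lemma complExponent_exchange {A : Finset V} {p q : V} (hq : q ∈ A) (hp : p ∉ A) :
    complExponent A + Finsupp.single q 1 - Finsupp.single p 1 =
      complExponent (insert p (A.erase q)) := by
  have hpq : p ≠ q := fun h => hp (h ▸ hq)
  ext v
  simp only [Finsupp.tsub_apply, Finsupp.add_apply, complExponent_apply, Finsupp.single_apply,
    Finset.mem_insert, Finset.mem_erase]
  by_cases h1 : v = p
  · subst h1
    simp [hp, hpq.symm]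
  · by_cases h2 : v = q
    · subst h2
      simp [hq, h1, Ne.symm h1]
    · simp [h1, h2, Ne.symm h1, Ne.symm h2]

lemma complExponent_injective : Function.Injective (complExponent (V := V)) := fun _ _ h =>
  (complExponent_le_iff.1 h.ge).antisymm (complExponent_le_iff.1 h.le)

lemma weaklyPolymatroidalWrt_dualIdeal_iff {lt : V → V → Prop} {Δ : Finset V → Prop} :
    WeaklyPolymatroidalWrt K lt (dualIdeal K Δ) ↔ FacetExchange lt Δ := by
  have hagree (A B : Finset V) (p : V) :
      complExponent A p = complExponent B p ↔ (p ∈ A ↔ p ∈ B) := by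
    simp only [complExponent_apply]
    by_cases h1 : p ∈ A <;> by_cases h2 : p ∈ B <;> simp [h1, h2]
  have hlt (A B : Finset V) (p : V) :
      complExponent A p < complExponent B p ↔ p ∈ A ∧ p ∉ B := by
    simp only [complExponent_apply]
    by_cases h1 : p ∈ A <;> by_cases h2 : p ∈ B <;> simp [h1, h2]
  have hpos (A : Finset V) (p : V) : 0 < complExponent A p ↔ p ∉ A := by
    simp only [complExponent_apply]
    by_cases h1 : p ∈ A <;> simp [h1]
  simp only [WeaklyPolymatroidalWrt, isMonoMinGen_dualIdeal_iff]
  constructor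
  · intro h A B hA hB q hag hqA hqB
    obtain ⟨p, hqp, hp, F, hF, hFe⟩ := h _ _ ⟨A, hA, rfl⟩ ⟨B, hB, rfl⟩ q
      (fun p hp => (hagree A B p).2 (hag p hp)) ((hlt A B q).2 ⟨hqA, hqB⟩)
    rw [hpos] at hp
    rw [complExponent_exchange hqA hp] at hFe
    exact ⟨p, hqp, hp, complExponent_injective hFe ▸ hF⟩
  · rintro h _ _ ⟨A, hA, rfl⟩ ⟨B, hB, rfl⟩ q hag hq
    obtain ⟨hqA, hqB⟩ := (hlt A B q).1 hq
    obtain ⟨p, hqp, hp, hF⟩ := h A B hA hB q (fun p hp => (hagree A B p).1 (hag p hp)) hqA hqB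
    exact ⟨p, hqp, (hpos A p).2 hp, _, hF, complExponent_exchange hqA hp⟩

end Facets

section Exchange

variable {V : Type} [DecidableEq V]

lemma isFacet_cplxLink_iff {Δ : Finset V → Prop} {x : V} {F : Finset V} :
    IsFacet (cplxLink Δ x) F ↔ x ∉ F ∧ IsFacet Δ (insert x F) := by
  constructor
  · rintro ⟨⟨hx, hF⟩, hmax⟩
    refine ⟨hx, hF, fun G hG hFG => ?_⟩
    have hxG : x ∈ G := hFG (Finset.mem_insert_self _ _)
    rw [hmax (G.erase x) ⟨Finset.notMem_erase _ _, by rwa [Finset.insert_erase hxG]⟩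
      (Finset.subset_erase.2 ⟨(Finset.subset_insert _ _).trans hFG, hx⟩),
      Finset.insert_erase hxG]
  · rintro ⟨hx, hF, hmax⟩
    refine ⟨⟨hx, hF⟩, fun G hG hFG => ?_⟩
    have := hmax _ hG.2 (Finset.insert_subset_insert _ hFG)
    rw [← Finset.erase_insert hx, this, Finset.erase_insert hG.1]

omit [DecidableEq V] in
lemma IsFacet.cplxDel {Δ : Finset V → Prop} {x : V} {F : Finset V} (hF : IsFacet Δ F)
    (hx : x ∉ F) : IsFacet (cplxDel Δ x) F :=
  ⟨⟨hx, hF.1⟩, fun G hG => hF.2 G hG.2⟩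

variable [Fintype V]

/-- The vertices lying in some but not all facets of `Δ`. -/
def varyingVertices (Δ : Finset V → Prop) : Set V :=
  {v | (∃ F, IsFacet Δ F ∧ v ∈ F) ∧ ∃ F, IsFacet Δ F ∧ v ∉ F}

lemma FacetExchange.vertexDecomposable_and_isPure (r : LinearOrder V) (n : ℕ)
    (Δ : Finset V → Prop) (hΔ : IsSimplicialComplex Δ) (h0 : Δ ∅)
    (hn : (varyingVertices Δ).ncard ≤ n) (h : FacetExchange r.lt Δ) : VertexDecomposable Δ ∧ IsPure Δ := by
  induction n generalizing Δ with
  | zero =>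
    have hvar : varyingVertices Δ = ∅ :=
      (Set.ncard_eq_zero (Set.toFinite _)).1 (Nat.le_zero.1 hn)
    have huniq : ∀ A B, IsFacet Δ A → IsFacet Δ B → A ⊆ B := fun A B hA hB v hv => by
      by_contra hvB
      exact (Set.eq_empty_iff_forall_notMem.1 hvar v) ⟨⟨A, hA, hv⟩, B, hB, hvB⟩
    obtain ⟨M, hM, -⟩ := exists_facet_of_face h0
    refine ⟨.simplex Δ M fun G => ⟨fun hG => ?_, fun hG => hΔ _ _ hM.1 hG⟩, fun A B hA hB => ?_⟩
    · obtain ⟨N, hN, hGN⟩ := exists_facet_of_face hG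
      exact hGN.trans (huniq N M hN hM)
    · rw [(huniq A B hA hB).antisymm (huniq B A hB hA)]
  | succ n ih =>
    by_cases hne : (varyingVertices Δ).Nonempty
    swap
    · exact ih Δ hΔ h0 (by simp [Set.not_nonempty_iff_eq_empty.1 hne]) h
    obtain ⟨q, hq, hmin⟩ : ∃ q ∈ varyingVertices Δ, ∀ v ∈ varyingVertices Δ, r.le q v :=
      Set.exists_min_image _ id (Set.toFinite _) hne
    obtain ⟨⟨A₀, hA₀, hqA₀⟩, B₀, hB₀, hqB₀⟩ := id hq
    have hexch : ∀ F, IsFacet Δ F → q ∈ F →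
        ∃ p, r.lt q p ∧ p ∉ F ∧ IsFacet Δ (insert p (F.erase q)) := by
      intro F hF hqF
      refine h F B₀ hF hB₀ q (fun p hp => ?_) hqF hqB₀
      by_contra hcon
      refine absurd (hmin p ?_) (not_le.2 hp)
      by_cases hpF : p ∈ F
      · exact ⟨⟨F, hF, hpF⟩, B₀, hB₀, fun hpB => hcon (by simp [hpF, hpB])⟩
      · exact ⟨⟨B₀, hB₀, by by_contra hpB; exact hcon (by simp [hpF, hpB])⟩, F, hF, hpF⟩
    have hdel : ∀ F, IsFacet (cplxDel Δ q) F ↔ q ∉ F ∧ IsFacet Δ F := by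
      refine fun F => ⟨fun hF => ⟨hF.1.1, ?_⟩, fun hF => hF.2.cplxDel hF.1⟩
      obtain ⟨M, hM, hFM⟩ := exists_facet_of_face hF.1.2
      by_cases hqM : q ∈ M
      · obtain ⟨p, hqp, hpM, hN⟩ := hexch M hM hqM
        have hqp' : q ≠ p := fun e => hpM (e ▸ hqM)
        have hFN : F = insert p (M.erase q) := hF.2 _ ⟨by simp [hqp'], hN.1⟩
          ((Finset.subset_erase.2 ⟨hFM, hF.1.1⟩).trans (Finset.subset_insert _ _))
        exact absurd (hFM (hFN ▸ Finset.mem_insert_self p _)) hpM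
      · rwa [hF.2 M ⟨hqM, hM.1⟩ hFM]
    have hsmall : ∀ Δ' : Finset V → Prop, varyingVertices Δ' ⊆ varyingVertices Δ →
        q ∉ varyingVertices Δ' → (varyingVertices Δ').ncard ≤ n := by
      intro Δ' hsub hqΔ'
      have := Set.ncard_lt_ncard (hsub.ssubset_of_mem_notMem hq hqΔ') (Set.toFinite _)
      omega
    obtain ⟨hvdL, hpureL⟩ := ih (cplxLink Δ q)
      (fun F G hF hGF => ⟨fun hG => hF.1 (hGF hG), hΔ _ _ hF.2 (Finset.insert_subset_insert _ hGF)⟩)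
      ⟨Finset.notMem_empty _, hΔ _ _ hA₀.1 (by simpa using hqA₀)⟩
      (hsmall _
        (by
          rintro v ⟨⟨F, hF, hvF⟩, F', hF', hvF'⟩
          rw [isFacet_cplxLink_iff] at hF hF'
          have hvq : v ≠ q := fun e => hF.1 (e ▸ hvF)
          exact ⟨⟨_, hF.2, by simp [hvF]⟩, _, hF'.2, by simp [hvF', hvq]⟩)
        (by
          rintro ⟨⟨F, hF, hvF⟩, -⟩
          exact hF.1.1 hvF))
      (by
        intro A B hA hB s hag hsA hsB
        rw [isFacet_cplxLink_iff] at hA hB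
        have hsq : s ≠ q := fun e => hA.1 (e ▸ hsA)
        obtain ⟨p, hsp, hp, hF⟩ := h _ _ hA.2 hB.2 s
          (fun p hp => by simp [hag p hp]) (by simp [hsA]) (by simp [hsB, hsq])
        simp only [Finset.mem_insert, not_or] at hp
        refine ⟨p, hsp, hp.2, isFacet_cplxLink_iff.2 ⟨?_, ?_⟩⟩
        · simp [Ne.symm hp.1, hA.1]
        · rwa [Finset.erase_insert_of_ne hsq.symm, Finset.insert_comm] at hF)
    obtain ⟨hvdD, hpureD⟩ := ih (cplxDel Δ q)
      (fun F G hF hGF => ⟨fun hG => hF.1 (hGF hG), hΔ _ _ hF.2 hGF⟩)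
      ⟨Finset.notMem_empty _, h0⟩
      (hsmall _
        (by
          rintro v ⟨⟨F, hF, hvF⟩, F', hF', hvF'⟩
          exact ⟨⟨F, ((hdel F).1 hF).2, hvF⟩, F', ((hdel F').1 hF').2, hvF'⟩)
        (by
          rintro ⟨⟨F, hF, hvF⟩, -⟩
          exact hF.1.1 hvF))
      (by
        intro A B hA hB s hag hsA hsB
        rw [hdel] at hA hB
        obtain ⟨p, hsp, hp, hF⟩ := h _ _ hA.2 hB.2 s hag hsA hsB
        refine ⟨p, hsp, hp, (hdel _).2 ⟨?_, hF⟩⟩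
        have hqs : r.le q s := hmin s ⟨⟨A, hA.2, hsA⟩, B, hB.2, hsB⟩
        have hqp : q ≠ p := (lt_of_le_of_lt hqs hsp).ne
        simp [hqp, hA.1])
    refine ⟨.shed Δ q (hΔ _ _ hA₀.1 (by simpa using hqA₀)) hvdL hvdD fun F hF hFD => ?_, ?_⟩
    · rw [isFacet_cplxLink_iff] at hF
      exact hF.1 (((hdel F).1 hFD).2.2 _ hF.2.1 (Finset.subset_insert _ _) ▸
        Finset.mem_insert_self _ _)
    · have hcard : ∀ F, IsFacet Δ F → F.card = B₀.card := by
        intro F hF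
        by_cases hqF : q ∈ F
        · obtain ⟨p, hqp, hpF, hN⟩ := hexch F hF hqF
          have hqp' : q ≠ p := fun e => hpF (e ▸ hqF)
          rw [← hpureD _ _ ((hdel _).2 ⟨by simp [hqp'], hN⟩) ((hdel _).2 ⟨hqB₀, hB₀⟩),
            Finset.card_insert_of_notMem (by simp [hpF]), Finset.card_erase_add_one hqF]
        · exact hpureD _ _ ((hdel _).2 ⟨hqF, hF⟩) ((hdel _).2 ⟨hqB₀, hB₀⟩)
      exact fun A B hA hB => (hcard A hA).trans (hcard B hB).symm

end Exchange

section Blocks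

variable {V : Type} {G : SimpleGraph V}

/-- The independence complex of the subgraph of `G` induced on `W`. -/
def indepCpxOn (G : SimpleGraph V) (W : Finset V) : Finset V → Prop :=
  fun F => F ⊆ W ∧ indepCpx G F

lemma indepCpx_singleton (v : V) : indepCpx G {v} := by
  simp [indepCpx]

lemma indepCpxOn_singleton {W : Finset V} {v : V} (hv : v ∈ W) : indepCpxOn G W {v} :=
  ⟨by simpa using hv, indepCpx_singleton v⟩

lemma indepCpxOn_univ [Fintype V] : indepCpxOn G Finset.univ = indepCpx G := by
  funext F
  simp [indepCpxOn]

lemma indepCpx.mono {F F' : Finset V} (h : indepCpx G F) (hF : F' ⊆ F) : indepCpx G F' :=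
  fun v hv w hw => h v (hF hv) w (hF hw)

variable [DecidableEq V]

lemma indepCpx.insert {F : Finset V} {y : V} (h : indepCpx G F)
    (hy : ∀ z ∈ F, ¬ G.Adj y z) : indepCpx G (insert y F) := by
  intro v hv w hw hvw
  rw [Finset.mem_insert] at hv hw
  rcases hv with rfl | hv <;> rcases hw with rfl | hw
  · exact G.irrefl hvw
  · exact hy _ hw hvw
  · exact hy _ hv hvw.symm
  · exact h _ hv _ hw hvw

lemma cplxDel_indepCpxOn {W : Finset V} {x : V} :
    cplxDel (indepCpxOn G W) x = indepCpxOn G (W.erase x) := by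
  funext F
  simp only [cplxDel, indepCpxOn, Finset.subset_erase, eq_iff_iff]
  tauto

lemma exists_indep_dominating (T U : Finset V) (hU : ∀ t ∈ T, ∃ u ∈ U, G.Adj t u)
    (hcomp : ∀ u ∈ U, ∀ w ∈ U, G.Adj u w → ∀ t ∈ T, ∀ t' ∈ T, G.Adj t u → G.Adj t' w →
      G.Adj t w ∨ G.Adj t' u) :
    ∃ I ⊆ U, indepCpx G I ∧ ∀ t ∈ T, ∃ u ∈ I, G.Adj t u := by
  classical
  obtain ⟨I, hI, hmax⟩ := Finset.exists_max_image (U.powerset.filter (indepCpx G))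
    (fun I => (T.filter fun t => ∃ u ∈ I, G.Adj t u).card) ⟨∅, by simp [indepCpx]⟩
  simp only [Finset.mem_filter, Finset.mem_powerset] at hI hmax
  refine ⟨I, hI.1, hI.2, ?_⟩
  by_contra! hcon
  obtain ⟨t, ht, htI⟩ := hcon
  obtain ⟨u, hu, htu⟩ := hU t ht
  have hle := hmax (insert u (I.filter fun w => ¬ G.Adj u w))
    ⟨Finset.insert_subset hu ((Finset.filter_subset _ _).trans hI.1),
      (hI.2.mono (Finset.filter_subset _ _)).insert fun z hz => (Finset.mem_filter.1 hz).2⟩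
  refine absurd hle (not_le.2 (Finset.card_lt_card ?_))
  rw [Finset.ssubset_iff_of_subset]
  · exact ⟨t, by simp [ht, htu], by simpa using fun _ => htI⟩
  · intro t' ht'
    simp only [Finset.mem_filter, Finset.mem_insert] at ht' ⊢
    obtain ⟨ht'T, w, hw, htw⟩ := ht'
    refine ⟨ht'T, ?_⟩
    by_cases huw : G.Adj u w
    · rcases hcomp u hu w (hI.1 hw) huw t ht t' ht'T htu htw with h | h
      · exact absurd h (htI w hw)
      · exact ⟨u, Or.inl rfl, h⟩
    · exact ⟨w, Or.inr ⟨hw, huw⟩, htw⟩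

/-- Every independent set of `G[W]` containing `x` leaves some neighbour of `x` in `W`
not dominated by its other vertices. -/
def IsShedding (G : SimpleGraph V) (W : Finset V) (x : V) : Prop :=
  ∀ A, indepCpxOn G W A → x ∈ A → ∃ y ∈ W, G.Adj x y ∧ ∀ z ∈ A, z ≠ x → ¬ G.Adj y z

variable [Fintype V]

lemma isShedding_of_facets {W : Finset V} {x : V}
    (h : ∀ F, IsFacet (cplxLink (indepCpxOn G W) x) F →
      ¬ IsFacet (cplxDel (indepCpxOn G W) x) F) : IsShedding G W x := by
  intro A hA hxA
  obtain ⟨F, hF, hAF⟩ := exists_facet_of_face (Δ := cplxLink (indepCpxOn G W) x)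
    (F := A.erase x) ⟨Finset.notMem_erase _ _, by rwa [Finset.insert_erase hxA]⟩
  have hFdel : cplxDel (indepCpxOn G W) x F :=
    ⟨hF.1.1, (Finset.subset_insert _ _).trans hF.1.2.1, hF.1.2.2.mono (Finset.subset_insert _ _)⟩
  have hnot := h F hF
  simp only [IsFacet, hFdel, true_and, not_forall] at hnot
  obtain ⟨M, hM, hFM, hne⟩ := hnot
  obtain ⟨y, hyM, hyF⟩ := Finset.exists_of_ssubset (hFM.ssubset_of_ne hne)
  have hxy : x ≠ y := fun e => hM.1 (e ▸ hyM)
  have hnadj : ∀ z ∈ F, ¬ G.Adj y z := fun z hz => hM.2.2 y hyM z (hFM hz)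
  refine ⟨y, hM.2.1 hyM, ?_, fun z hz hzx => hnadj z (hAF (Finset.mem_erase.2 ⟨hzx, hz⟩))⟩
  by_contra hadj
  refine hyF (hF.2 (insert y F) ⟨by simp [hxy, hF.1.1], ?_, ?_⟩ (Finset.subset_insert _ _) ▸
    Finset.mem_insert_self _ _)
  · rw [Finset.insert_comm]
    exact Finset.insert_subset (hM.2.1 hyM) hF.1.2.1
  · rw [Finset.insert_comm]
    refine hF.1.2.2.insert fun z hz => ?_
    rcases Finset.mem_insert.1 hz with rfl | hz
    · exact fun h => hadj h.symm
    · exact hnadj z hz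

omit [Fintype V] in
lemma IsShedding.isFacet_of_isFacet_erase {W : Finset V} {x : V} (hx : IsShedding G W x)
    {F : Finset V} (hF : IsFacet (indepCpxOn G (W.erase x)) F) : IsFacet (indepCpxOn G W) F := by
  refine ⟨⟨hF.1.1.trans (Finset.erase_subset _ _), hF.1.2⟩, fun M hM hFM => ?_⟩
  by_cases hxM : x ∈ M
  · obtain ⟨y, hyW, hxy, hy⟩ := hx M hM hxM
    have hyF : y ∉ F := fun h => hM.2 x hxM y (hFM h) hxy
    refine absurd (Finset.mem_insert_self y F) (hF.2 (insert y F) ⟨?_, ?_⟩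
      (Finset.subset_insert _ _) ▸ hyF)
    · exact Finset.insert_subset (Finset.mem_erase.2 ⟨hxy.ne', hyW⟩) hF.1.1
    · exact hF.1.2.insert fun z hz => hy z (hFM hz) (Finset.ne_of_mem_erase (hF.1.1 hz))
  · exact hF.2 M ⟨Finset.subset_erase.2 ⟨hM.1, hxM⟩, hM.2⟩ hFM

omit [Fintype V] in
lemma IsFacet.indepCpxOn_erase {W : Finset V} {x : V} {A : Finset V}
    (hA : IsFacet (indepCpxOn G W) A) (hx : x ∉ A) :
    IsFacet (indepCpxOn G (W.erase x)) A :=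
  cplxDel_indepCpxOn (G := G) ▸ hA.cplxDel hx

lemma isFacet_exchange {W : Finset V} (hpure : IsPure (indepCpxOn G W)) {A : Finset V} {p q : V}
    (hA : IsFacet (indepCpxOn G W) A) (hq : q ∈ A) (hpA : p ∉ A) (hp : p ∈ W)
    (hadj : ∀ z ∈ A, z ≠ q → ¬ G.Adj p z) :
    IsFacet (indepCpxOn G W) (insert p (A.erase q)) := by
  refine isFacet_of_card_eq hpure ⟨Finset.insert_subset hp ((Finset.erase_subset _ _).trans hA.1.1),
    (hA.1.2.mono (Finset.erase_subset _ _)).insert fun z hz =>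
      hadj z (Finset.mem_of_mem_erase hz) (Finset.ne_of_mem_erase hz)⟩ hA ?_
  rw [Finset.card_insert_of_notMem (by simp [hpA]), Finset.card_erase_add_one hq]

lemma IsShedding.exists_exchange {W : Finset V} {x : V} (hx : IsShedding G W x)
    (hpure : IsPure (indepCpxOn G W)) {A : Finset V} (hA : IsFacet (indepCpxOn G W) A)
    (hxA : x ∈ A) : ∃ y, G.Adj x y ∧
      IsFacet (indepCpxOn G (W.erase x)) (insert y (A.erase x)) := by
  obtain ⟨y, hyW, hxy, hy⟩ := hx A hA.1 hxA
  refine ⟨y, hxy, (isFacet_exchange hpure hA hxA ?_ hyW hy).indepCpxOn_erase ?_⟩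
  · exact fun h => hA.1.2 x hxA y h hxy
  · simp [hxy.ne]

/-- The fibre of `f` over `i` in `W` is a clique met by every facet, and it either has at least
three vertices or contains a vertex all of whose neighbours lie in the blocks up to `i`. -/
def IsCliqueBlock (G : SimpleGraph V) (W : Finset V) (f : V → ℕ) (i : ℕ) : Prop :=
  (∀ u ∈ W, ∀ v ∈ W, f u = i → f v = i → u ≠ v → G.Adj u v) ∧
  (∀ A, IsFacet (indepCpxOn G W) A → ∃ p ∈ A, f p = i) ∧
  (3 ≤ (W.filter (f · = i)).card ∨ ∃ y ∈ W, f y = i ∧ ∀ z ∈ W, G.Adj z y → f z ≤ i)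

/-- `a, b, c, d, e` is a 5-cycle of `G`. -/
structure IsFiveCycle (G : SimpleGraph V) (a b c d e : V) : Prop where
  ab : G.Adj a b
  bc : G.Adj b c
  cd : G.Adj c d
  de : G.Adj d e
  ea : G.Adj e a
  ac : a ≠ c
  bd : b ≠ d
  ce : c ≠ e
  da : d ≠ a
  eb : e ≠ b

/-- The fibre of `f` over `i` in `W` spans a 5-cycle which every facet meets in at least
two vertices. -/
def IsFiveBlock (G : SimpleGraph V) (W : Finset V) (f : V → ℕ) (i : ℕ) : Prop :=
  (∃ a b c d e, IsFiveCycle G a b c d e ∧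
    ∀ v, v ∈ W ∧ f v = i ↔ v = a ∨ v = b ∨ v = c ∨ v = d ∨ v = e) ∧
  ∀ A, IsFacet (indepCpxOn G W) A → ∃ p ∈ A, ∃ r ∈ A, p ≠ r ∧ f p = i ∧ f r = i

/-- Every fibre of `f` in `W` is a clique block or, for a cactus graph, a 5-cycle block. -/
def IsBlockFunction (G : SimpleGraph V) (W : Finset V) (f : V → ℕ) : Prop :=
  ∀ v ∈ W, IsCliqueBlock G W f (f v) ∨ (IsCactus G ∧ IsFiveBlock G W f (f v))

omit [Fintype V] in
lemma block_transfer {W : Finset V} {x : V} {f g : V → ℕ} {i j : ℕ}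
    (hfib : ∀ v ∈ W, g v = j ↔ v ≠ x ∧ f v = i)
    (hmono : ∀ v ∈ W, v = x ∨ f v ≤ i → g v ≤ j)
    (hfacet : ∀ A, IsFacet (indepCpxOn G W) A → ∃ B, IsFacet (indepCpxOn G (W.erase x)) B ∧
      ∀ p ∈ B, f p = i → p ∈ A)
    (h : IsCliqueBlock G (W.erase x) f i ∨ (IsCactus G ∧ IsFiveBlock G (W.erase x) f i)) :
    IsCliqueBlock G W g j ∨ (IsCactus G ∧ IsFiveBlock G W g j) := by
  have hmem : ∀ v, v ∈ W ∧ g v = j ↔ v ∈ W.erase x ∧ f v = i := by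
    intro v
    rw [Finset.mem_erase]
    constructor
    · rintro ⟨hv, h⟩
      obtain ⟨h1, h2⟩ := (hfib v hv).1 h
      exact ⟨⟨h1, hv⟩, h2⟩
    · rintro ⟨⟨h1, hv⟩, h2⟩
      exact ⟨hv, (hfib v hv).2 ⟨h1, h2⟩⟩
  refine h.imp ?_ (And.imp_right ?_)
  · rintro ⟨hcl, hhit, hcard⟩
    refine ⟨fun u hu v hv hgu hgv => ?_, fun A hA => ?_, hcard.imp ?_ ?_⟩
    · exact hcl u ((hmem u).1 ⟨hu, hgu⟩).1 v ((hmem v).1 ⟨hv, hgv⟩).1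
        ((hmem u).1 ⟨hu, hgu⟩).2 ((hmem v).1 ⟨hv, hgv⟩).2
    · obtain ⟨B, hB, hBA⟩ := hfacet A hA
      obtain ⟨p, hp, hfp⟩ := hhit B hB
      exact ⟨p, hBA p hp hfp, ((hmem p).2 ⟨hB.1.1 hp, hfp⟩).2⟩
    · intro h3
      convert h3 using 2
      ext v
      simpa using hmem v
    · rintro ⟨y, hy, hfy, hmax⟩
      obtain ⟨hyW, hgy⟩ := (hmem y).2 ⟨hy, hfy⟩
      refine ⟨y, hyW, hgy, fun z hz hzy => hmono z hz ?_⟩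
      by_cases hzx : z = x
      · exact Or.inl hzx
      · exact Or.inr (hmax z (Finset.mem_erase.2 ⟨hzx, hz⟩) hzy)
  · rintro ⟨⟨a, b, c, d, e, hC, hCfib⟩, hhit⟩
    refine ⟨⟨a, b, c, d, e, hC, fun v => (hmem v).trans (hCfib v)⟩, fun A hA => ?_⟩
    obtain ⟨B, hB, hBA⟩ := hfacet A hA
    obtain ⟨p, hp, r, hr, hpr, hfp, hfr⟩ := hhit B hB
    exact ⟨p, hBA p hp hfp, r, hBA r hr hfr, hpr, ((hmem p).2 ⟨hB.1.1 hp, hfp⟩).2,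
      ((hmem r).2 ⟨hB.1.1 hr, hfr⟩).2⟩

lemma exists_blockFunction_of_cliqueBlock {W : Finset V} {x y : V} (hxW : x ∈ W)
    (hpure : IsPure (indepCpxOn G W)) (hx : IsShedding G W x) {f : V → ℕ}
    (hf : IsBlockFunction G (W.erase x) f) (hyW : y ∈ W) (hxy : G.Adj x y)
    (hdom : ∀ z ∈ W, G.Adj y z → z = x ∨ G.Adj x z)
    (hy : IsCliqueBlock G (W.erase x) f (f y)) : ∃ g, IsBlockFunction G W g := by
  obtain ⟨hcl, hhit, -⟩ := hy
  have hyW' : y ∈ W.erase x := Finset.mem_erase.2 ⟨hxy.ne', hyW⟩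
  have hQ : ∀ v ∈ W.erase x, f v = f y → G.Adj x v := by
    intro v hv hvy
    by_cases hvy' : v = y
    · rwa [hvy']
    · exact (hdom v (Finset.mem_of_mem_erase hv)
        (hcl y hyW' v hv rfl hvy (Ne.symm hvy'))).resolve_left (Finset.ne_of_mem_erase hv)
  set g : V → ℕ := fun v => if v = x ∨ f v = f y then 0 else f v + 1 with hg
  have hg0 : ∀ v, g v = 0 ↔ v = x ∨ f v = f y := fun v => by
    simp [hg, or_iff_not_imp_left]
  refine ⟨g, fun v hv => ?_⟩
  by_cases hv0 : v = x ∨ f v = f y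
  · rw [(hg0 v).2 hv0]
    refine Or.inl ⟨fun u hu v hv hu0 hv0 huv => ?_, fun A hA => ?_, ?_⟩
    · rw [hg0] at hu0 hv0
      by_cases hux : u = x
      · subst hux
        exact hQ v (Finset.mem_erase.2 ⟨huv.symm, hv⟩) (hv0.resolve_left huv.symm)
      · by_cases hvx : v = x
        · subst hvx
          exact (hQ u (Finset.mem_erase.2 ⟨huv, hu⟩) (hu0.resolve_left huv)).symm
        · exact hcl u (Finset.mem_erase.2 ⟨hux, hu⟩) v (Finset.mem_erase.2 ⟨hvx, hv⟩)
            (hu0.resolve_left hux) (hv0.resolve_left hvx) huv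
    · by_cases hxA : x ∈ A
      · exact ⟨x, hxA, (hg0 x).2 (Or.inl rfl)⟩
      · obtain ⟨p, hp, hfp⟩ := hhit A (hA.indepCpxOn_erase hxA)
        exact ⟨p, hp, (hg0 p).2 (Or.inr hfp)⟩
    · by_cases hthird : ∃ w ∈ W.erase x, f w = f y ∧ w ≠ y
      · left
        obtain ⟨w, hw, hfw, hwy⟩ := hthird
        have hcard : ({x, y, w} : Finset V).card = 3 :=
          Finset.card_eq_three.2 ⟨x, y, w, hxy.ne, (Finset.ne_of_mem_erase hw).symm, hwy.symm, rfl⟩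
        rw [← hcard]
        refine Finset.card_le_card fun v hv => ?_
        simp only [Finset.mem_insert, Finset.mem_singleton] at hv
        rw [Finset.mem_filter, hg0]
        rcases hv with rfl | rfl | rfl
        · exact ⟨hxW, Or.inl rfl⟩
        · exact ⟨hyW, Or.inr rfl⟩
        · exact ⟨Finset.mem_of_mem_erase hw, Or.inr hfw⟩
      · right
        push Not at hthird
        refine ⟨y, hyW, (hg0 y).2 (Or.inr rfl), fun z hz hzy => ?_⟩
        rw [Nat.le_zero, hg0]
        by_contra! hcon
        obtain ⟨B, hB, hzB⟩ := exists_facet_of_face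
          (indepCpxOn_singleton (G := G) (Finset.mem_erase.2 ⟨hcon.1, hz⟩))
        obtain ⟨p, hp, hfp⟩ := hhit B hB
        rw [hthird p (hB.1.1 hp) hfp] at hp
        exact hB.1.2 z (hzB (Finset.mem_singleton_self z)) y hp hzy
  · push Not at hv0
    have hgv : g v = f v + 1 := by simp [hg, hv0.1, hv0.2]
    rw [hgv]
    refine block_transfer (f := f) (i := f v) (fun w hw => ?_) (fun w hw => ?_)
      (fun A hA => ?_) (hf v (Finset.mem_erase.2 ⟨hv0.1, hv⟩))
    · by_cases hw0 : w = x ∨ f w = f y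
      · rw [(hg0 w).2 hw0]
        simp only [(Nat.succ_ne_zero _).symm, false_iff, not_and]
        intro hwx
        rw [hw0.resolve_left hwx]
        exact hv0.2.symm
      · have : g w = f w + 1 := by simp only [hg, hw0, if_false]
        rw [this]
        push Not at hw0
        simp [hw0.1]
    · simp only [hg]
      split_ifs with h
      · simp
      · push Not at h
        simp [h.1]
    · by_cases hxA : x ∈ A
      · obtain ⟨y', hxy', hB⟩ := hx.exists_exchange hpure hA hxA
        refine ⟨_, hB, fun p hp hfp => ?_⟩
        have hfy' : f y' = f y := by
          obtain ⟨r, hr, hfr⟩ := hhit _ hB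
          rcases Finset.mem_insert.1 hr with rfl | hr'
          · exact hfr
          · exact absurd (hQ r (hB.1.1 hr) hfr) (hA.1.2 x hxA r (Finset.mem_of_mem_erase hr'))
        rcases Finset.mem_insert.1 hp with rfl | hp
        · exact absurd (hfp.symm.trans hfy') hv0.2
        · exact Finset.mem_of_mem_erase hp
      · exact ⟨A, hA.indepCpxOn_erase hxA, fun p hp _ => hp⟩

omit [Fintype V] in
lemma IsFiveCycle.exists_ne_adj {a b c d e v z : V} (h : IsFiveCycle G a b c d e)
    (hv : v = a ∨ v = b ∨ v = c ∨ v = d ∨ v = e) :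
    ∃ w, (w = a ∨ w = b ∨ w = c ∨ w = d ∨ w = e) ∧ G.Adj v w ∧ w ≠ z := by
  have key : ∀ p q, (p = a ∨ p = b ∨ p = c ∨ p = d ∨ p = e) →
      (q = a ∨ q = b ∨ q = c ∨ q = d ∨ q = e) → G.Adj v p → G.Adj v q → p ≠ q →
      ∃ w, (w = a ∨ w = b ∨ w = c ∨ w = d ∨ w = e) ∧ G.Adj v w ∧ w ≠ z := by
    intro p q hp hq hvp hvq hpq
    by_cases hpz : p = z
    · exact ⟨q, hq, hvq, fun hqz => hpq (hpz.trans hqz.symm)⟩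
    · exact ⟨p, hp, hvp, hpz⟩
  rcases hv with rfl | rfl | rfl | rfl | rfl
  · exact key b e (by simp) (by simp) h.ab h.ea.symm h.eb.symm
  · exact key a c (by simp) (by simp) h.ab.symm h.bc h.ac
  · exact key b d (by simp) (by simp) h.bc.symm h.cd h.bd
  · exact key c e (by simp) (by simp) h.cd.symm h.de h.ce
  · exact key d a (by simp) (by simp) h.de.symm h.ea h.da

lemma IsBlockFunction.leaf_block {W : Finset V} {f : V → ℕ} (hf : IsBlockFunction G W f)
    {y z : V} (hy : y ∈ W) (hz : z ∈ W) (hyz : G.Adj y z) (hleaf : ∀ v ∈ W, G.Adj y v → v = z) :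
    (∀ v ∈ W, f v = f y ↔ v = y ∨ v = z) ∧
      ∀ B, IsFacet (indepCpxOn G W) B → y ∈ B ∨ z ∈ B := by
  rcases hf y hy with ⟨hcl, hhit, -⟩ | ⟨-, ⟨a, b, c, d, e, hC, hfib⟩, -⟩
  · have hsub : ∀ v ∈ W, f v = f y → v = y ∨ v = z := by
      intro v hv hfv
      by_cases hvy : v = y
      · exact Or.inl hvy
      · exact Or.inr (hleaf v hv (hcl y hy v hv rfl hfv (Ne.symm hvy)))
    have hhit' : ∀ B, IsFacet (indepCpxOn G W) B → ∃ p ∈ B, f p = f y ∧ (p = y ∨ p = z) :=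
      fun B hB => by
        obtain ⟨p, hp, hfp⟩ := hhit B hB
        exact ⟨p, hp, hfp, hsub p (hB.1.1 hp) hfp⟩
    refine ⟨fun v hv => ⟨hsub v hv, ?_⟩, fun B hB => ?_⟩
    · rintro (rfl | rfl)
      · rfl
      · obtain ⟨B, hB, hvB⟩ := exists_facet_of_face (indepCpxOn_singleton (G := G) hv)
        obtain ⟨p, hp, hfp, rfl | rfl⟩ := hhit' B hB
        · exact absurd hyz (hB.1.2 p hp v (hvB (Finset.mem_singleton_self v)))
        · exact hfp
    · obtain ⟨p, hp, -, rfl | rfl⟩ := hhit' B hB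
      · exact Or.inl hp
      · exact Or.inr hp
  · obtain ⟨w, hw, hyw, hwz⟩ := hC.exists_ne_adj (z := z) ((hfib y).1 ⟨hy, rfl⟩)
    exact absurd (hleaf w ((hfib w).2 hw).1 hyw) hwz

lemma exists_blockFunction_of_fiveCycle (hG : IsCactus G) {W : Finset V} {x t u w t' : V}
    (hxW : x ∈ W) (hpure : IsPure (indepCpxOn G W)) (hx : IsShedding G W x) {f : V → ℕ}
    (hf : IsBlockFunction G (W.erase x) f) (hC : IsFiveCycle G x t u w t')
    (htW : t ∈ W) (huW : u ∈ W) (hwW : w ∈ W) (ht'W : t' ∈ W)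
    (ht : ∀ z ∈ W, G.Adj t z → z = x ∨ z = u) (ht' : ∀ z ∈ W, G.Adj t' z → z = x ∨ z = w) :
    ∃ g, IsBlockFunction G W g := by
  obtain ⟨hfib, hhit⟩ := hf.leaf_block (y := t) (z := u) (Finset.mem_erase.2 ⟨hC.ab.ne', htW⟩)
    (Finset.mem_erase.2 ⟨hC.ac.symm, huW⟩) hC.bc fun v hv htv =>
      (ht v (Finset.mem_of_mem_erase hv) htv).resolve_left (Finset.ne_of_mem_erase hv)
  obtain ⟨hfib', hhit'⟩ := hf.leaf_block (y := t') (z := w)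
    (Finset.mem_erase.2 ⟨hC.ea.ne, ht'W⟩)
    (Finset.mem_erase.2 ⟨hC.da, hwW⟩) hC.de.symm fun v hv htv =>
      (ht' v (Finset.mem_of_mem_erase hv) htv).resolve_left (Finset.ne_of_mem_erase hv)
  have hexch : ∀ A, IsFacet (indepCpxOn G W) A → x ∈ A →
      ∃ y, (y = t ∧ w ∈ A ∨ y = t' ∧ u ∈ A) ∧
        IsFacet (indepCpxOn G (W.erase x)) (insert y (A.erase x)) := by
    intro A hA hxA
    obtain ⟨y, hxy, hB⟩ := hx.exists_exchange hpure hA hxA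
    refine ⟨y, ?_, hB⟩
    have htA : t ∉ A := fun h => hA.1.2 x hxA t h hC.ab
    have ht'A : t' ∉ A := fun h => hA.1.2 x hxA t' h hC.ea.symm
    have h1 := hhit _ hB
    have h2 := hhit' _ hB
    have huw : u ∈ A → w ∉ A := fun hu hw => hA.1.2 u hu w hw hC.cd
    have htu := hC.bc.ne
    have htt' := hC.eb
    have htw := hC.bd
    have hut' := hC.ce
    have hwt' := hC.de.ne
    have huw' := hC.cd.ne
    have hyu : y = u → w ∉ A := by
      rintro rfl hw
      exact hB.1.2 y (by simp) w (by simp [hw, hC.da]) hC.cd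
    have hyw : y = w → u ∉ A := by
      rintro rfl hu
      exact hB.1.2 y (by simp) u (by simp [hu, hC.ac.symm]) hC.cd.symm
    simp only [Finset.mem_insert, Finset.mem_erase, htA, ht'A, and_false, or_false] at h1 h2
    rcases h1 with rfl | rfl | h1
    · rcases h2 with h2 | h2 | h2
      · exact absurd h2 htt'
      · exact absurd h2.symm htw
      · exact Or.inl ⟨rfl, h2.2⟩
    · rcases h2 with h2 | h2 | h2
      · exact absurd h2.symm hut'
      · exact absurd h2.symm huw'
      · exact absurd h2.2 (hyu rfl)
    · rcases h2 with rfl | rfl | h2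
      · exact Or.inr ⟨rfl, h1.2⟩
      · exact absurd h1.2 (hyw rfl)
      · exact absurd h2.2 (huw h1.2)
  have hfu : f u = f t := (hfib u (Finset.mem_erase.2 ⟨hC.ac.symm, huW⟩)).2 (Or.inr rfl)
  have hfw : f w = f t' := (hfib' w (Finset.mem_erase.2 ⟨hC.da, hwW⟩)).2 (Or.inr rfl)
  set g : V → ℕ := fun v => if v = x ∨ v = t ∨ v = u ∨ v = w ∨ v = t' then 0 else f v + 1 with hg
  have hg0 : ∀ v, g v = 0 ↔ v = x ∨ v = t ∨ v = u ∨ v = w ∨ v = t' := fun v => by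
    simp [hg, or_iff_not_imp_left]
  refine ⟨g, fun v hv => ?_⟩
  by_cases hv0 : v = x ∨ v = t ∨ v = u ∨ v = w ∨ v = t'
  · rw [(hg0 v).2 hv0]
    refine Or.inr ⟨hG, ⟨x, t, u, w, t', hC, fun v => ?_⟩, fun A hA => ?_⟩
    · rw [hg0, and_iff_right_iff_imp]
      rintro (rfl | rfl | rfl | rfl | rfl) <;> assumption
    · simp only [hg0]
      by_cases hxA : x ∈ A
      · obtain ⟨y, ⟨-, hw⟩ | ⟨-, hu⟩, -⟩ := hexch A hA hxA
        · exact ⟨x, hxA, w, hw, hC.da.symm, by simp, by simp⟩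
        · exact ⟨x, hxA, u, hu, hC.ac, by simp, by simp⟩
      · have hA' := hA.indepCpxOn_erase hxA
        rcases hhit A hA' with h | h <;> rcases hhit' A hA' with h' | h'
        · exact ⟨t, h, t', h', hC.eb.symm, by simp, by simp⟩
        · exact ⟨t, h, w, h', hC.bd, by simp, by simp⟩
        · exact ⟨u, h, t', h', hC.ce, by simp, by simp⟩
        · exact ⟨u, h, w, h', hC.cd.ne, by simp, by simp⟩
  · have hgv : g v = f v + 1 := by simp only [hg, hv0, if_false]
    push Not at hv0
    have hvW : v ∈ W.erase x := Finset.mem_erase.2 ⟨hv0.1, hv⟩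
    have hvt : f v ≠ f t := fun h => by
      have := (hfib v hvW).1 h
      tauto
    have hvt' : f v ≠ f t' := fun h => by
      have := (hfib' v hvW).1 h
      tauto
    rw [hgv]
    refine block_transfer (f := f) (i := f v) (fun p hp => ?_) (fun p hp => ?_)
      (fun A hA => ?_) (hf v hvW)
    · by_cases hp0 : p = x ∨ p = t ∨ p = u ∨ p = w ∨ p = t'
      · rw [(hg0 p).2 hp0]
        simp only [(Nat.succ_ne_zero _).symm, false_iff, not_and]
        intro hpx
        rcases hp0 with rfl | rfl | rfl | rfl | rfl
        · exact absurd rfl hpx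
        · exact hvt.symm
        · exact hfu ▸ hvt.symm
        · exact hfw ▸ hvt'.symm
        · exact hvt'.symm
      · have : g p = f p + 1 := by simp only [hg, hp0, if_false]
        rw [this]
        push Not at hp0
        simp [hp0.1]
    · simp only [hg]
      split_ifs with h
      · simp
      · push Not at h
        simp [h.1]
    · by_cases hxA : x ∈ A
      · obtain ⟨y, hy, hB⟩ := hexch A hA hxA
        refine ⟨_, hB, fun p hp hfp => ?_⟩
        rcases Finset.mem_insert.1 hp with rfl | hp
        · rcases hy with ⟨rfl, -⟩ | ⟨rfl, -⟩
          · exact absurd hfp.symm hvt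
          · exact absurd hfp.symm hvt'
        · exact Finset.mem_of_mem_erase hp
      · exact ⟨A, hA.indepCpxOn_erase hxA, fun p hp _ => hp⟩

end Blocks

section Cycles

open SimpleGraph

variable {V : Type} {G : SimpleGraph V}

lemma IsFiveCycle.rotate {a b c d e : V} (h : IsFiveCycle G a b c d e) :
    IsFiveCycle G b c d e a :=
  ⟨h.bc, h.cd, h.de, h.ea, h.ab, h.bd, h.ce, h.da, h.eb, h.ac⟩

lemma IsFiveCycle.reflect {a b c d e : V} (h : IsFiveCycle G a b c d e) :
    IsFiveCycle G b a e d c :=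
  ⟨h.ab.symm, h.ea.symm, h.de.symm, h.cd.symm, h.bc.symm, h.eb.symm, h.da.symm, h.ce.symm,
    h.bd.symm, h.ac.symm⟩

lemma exists_isCycle_three {a b c : V} (hab : G.Adj a b) (hbc : G.Adj b c) (hca : G.Adj c a) :
    ∃ w : G.Walk a a, w.IsCycle ∧ w.edges = [s(a, b), s(b, c), s(c, a)] ∧
      w.support = [a, b, c, a] := by
  refine ⟨.cons hab (.cons hbc (.cons hca .nil)), ?_, rfl, rfl⟩
  have := hab.ne
  have := hbc.ne
  have := hca.ne
  simp [Walk.isCycle_def, Walk.isTrail_cons]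
  grind

lemma exists_isCycle_four {a b c d : V} (hab : G.Adj a b) (hbc : G.Adj b c) (hcd : G.Adj c d)
    (hda : G.Adj d a) (hac : a ≠ c) (hbd : b ≠ d) :
    ∃ w : G.Walk a a, w.IsCycle ∧ w.edges = [s(a, b), s(b, c), s(c, d), s(d, a)] ∧
      w.support = [a, b, c, d, a] := by
  refine ⟨.cons hab (.cons hbc (.cons hcd (.cons hda .nil))), ?_, rfl, rfl⟩
  have := hab.ne
  have := hbc.ne
  have := hcd.ne
  have := hda.ne
  simp [Walk.isCycle_def, Walk.isTrail_cons]
  grind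

lemma IsFiveCycle.exists_isCycle {a b c d e : V} (h : IsFiveCycle G a b c d e) :
    ∃ w : G.Walk a a, w.IsCycle ∧ w.edges = [s(a, b), s(b, c), s(c, d), s(d, e), s(e, a)] ∧
      w.support = [a, b, c, d, e, a] := by
  obtain ⟨hab, hbc, hcd, hde, hea, hac, hbd, hce, hda, heb⟩ := h
  refine ⟨.cons hab (.cons hbc (.cons hcd (.cons hde (.cons hea .nil)))), ?_, rfl, rfl⟩
  have := hab.ne
  have := hbc.ne
  have := hcd.ne
  have := hde.ne
  have := hea.ne
  simp [Walk.isCycle_def, Walk.isTrail_cons]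
  grind

lemma isCycleSubgraph_toSubgraph {u : V} {c : G.Walk u u} (hc : c.IsCycle) :
    IsCycleSubgraph G c.toSubgraph :=
  ⟨c.toSubgraph_connected, fun _ hv =>
    hc.ncard_neighborSet_toSubgraph_eq_two (c.mem_verts_toSubgraph.1 hv)⟩

lemma IsCactus.mem_support_iff (hG : IsCactus G) {u v : V} {c : G.Walk u u} {c' : G.Walk v v}
    (hc : c.IsCycle) (hc' : c'.IsCycle) {e : Sym2 V} (he : e ∈ c.edges) (he' : e ∈ c'.edges)
    (z : V) : z ∈ c.support ↔ z ∈ c'.support := by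
  rw [← Walk.mem_verts_toSubgraph, ← Walk.mem_verts_toSubgraph,
    hG _ _ (isCycleSubgraph_toSubgraph hc) (isCycleSubgraph_toSubgraph hc') e
      (c.mem_edges_toSubgraph.2 he) (c'.mem_edges_toSubgraph.2 he')]

lemma IsCactus.triangle_unique (hG : IsCactus G) {a b p q : V} (hab : G.Adj a b)
    (hbp : G.Adj b p) (hpa : G.Adj p a) (hbq : G.Adj b q) (hqa : G.Adj q a) : p = q := by
  obtain ⟨c, hc, hce, hcs⟩ := exists_isCycle_three hab hbp hpa
  obtain ⟨c', hc', hce', hcs'⟩ := exists_isCycle_three hab hbq hqa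
  have h := hG.mem_support_iff hc hc' (e := s(a, b)) (by simp [hce]) (by simp [hce']) p
  rw [hcs, hcs'] at h
  simpa [hbp.ne', hpa.ne] using h

lemma IsCactus.not_triangle_square (hG : IsCactus G) {a b c p q : V} (hab : G.Adj a b)
    (hbc : G.Adj b c) (hca : G.Adj c a) (hbp : G.Adj b p) (hpq : G.Adj p q) (hqa : G.Adj q a)
    (hap : a ≠ p) (hbq : b ≠ q) : False := by
  obtain ⟨w, hw, hwe, hws⟩ := exists_isCycle_three hab hbc hca
  obtain ⟨w', hw', hwe', hws'⟩ := exists_isCycle_four hab hbp hpq hqa hap hbq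
  have h := hG.mem_support_iff hw hw' (e := s(a, b)) (by simp [hwe]) (by simp [hwe'])
  rw [hws, hws'] at h
  have hp := h p
  have hq := h q
  have := hbp.ne
  have := hpq.ne
  have := hqa.ne
  simp at hp hq
  grind

lemma IsCactus.not_triangle_fiveCycle (hG : IsCactus G) {a b c p q r : V}
    (hC : IsFiveCycle G a b p q r) (hbc : G.Adj b c) (hca : G.Adj c a) : False := by
  obtain ⟨w, hw, hwe, hws⟩ := exists_isCycle_three hC.ab hbc hca
  obtain ⟨w', hw', hwe', hws'⟩ := hC.exists_isCycle
  have h := hG.mem_support_iff hw hw' (e := s(a, b)) (by simp [hwe]) (by simp [hwe'])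
  rw [hws, hws'] at h
  have hp := h p
  have hq := h q
  have := hC.bc.ne
  have := hC.cd.ne
  have := hC.ac
  have := hC.bd
  have := hC.da
  simp at hp hq
  grind

lemma IsCactus.not_square_fiveCycle (hG : IsCactus G) {a b c d p q r : V}
    (hC : IsFiveCycle G a b p q r) (hbc : G.Adj b c) (hcd : G.Adj c d) (hda : G.Adj d a)
    (hac : a ≠ c) (hbd : b ≠ d) : False := by
  obtain ⟨w, hw, hwe, hws⟩ := exists_isCycle_four hC.ab hbc hcd hda hac hbd
  obtain ⟨w', hw', hwe', hws'⟩ := hC.exists_isCycle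
  have h := hG.mem_support_iff hw hw' (e := s(a, b)) (by simp [hwe]) (by simp [hwe'])
  rw [hws, hws'] at h
  have hp := h p
  have hq := h q
  have hr := h r
  obtain ⟨h1, h2, h3, h4, h5, h6, h7, h8, h9, h10⟩ := hC
  have := h1.ne
  have := h2.ne
  have := h3.ne
  have := h4.ne
  have := h5.ne
  simp at hp hq hr
  grind

lemma IsCactus.fiveCycle_unique (hG : IsCactus G) {a b c d e p q r : V}
    (hC : IsFiveCycle G a b c d e) (hC' : IsFiveCycle G a b p q r) : p = c := by
  obtain ⟨w, hw, hwe, hws⟩ := hC.exists_isCycle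
  obtain ⟨w', hw', hwe', hws'⟩ := hC'.exists_isCycle
  have h := hG.mem_support_iff hw hw' (e := s(a, b)) (by simp [hwe]) (by simp [hwe'])
  rw [hws, hws'] at h
  have hp := h p
  simp only [List.mem_cons, List.not_mem_nil, or_false, true_or, or_true, iff_true] at hp
  rcases hp with rfl | rfl | rfl | rfl | rfl | rfl
  · exact absurd rfl hC'.ac
  · exact absurd hC'.bc G.irrefl
  · rfl
  · exact (hG.not_triangle_fiveCycle hC.rotate hC.cd hC'.bc.symm).elim
  · exact (hG.not_triangle_fiveCycle hC hC'.bc hC.ea).elim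
  · exact absurd rfl hC'.ac

lemma IsChordal.adj_of_square (hG : IsChordal G) {a b c d : V} (hab : G.Adj a b)
    (hbc : G.Adj b c) (hcd : G.Adj c d) (hda : G.Adj d a) (hac : a ≠ c) (hbd : b ≠ d) :
    G.Adj a c ∨ G.Adj b d := by
  obtain ⟨w, hw, hwe, hws⟩ := exists_isCycle_four hab hbc hcd hda hac hbd
  obtain ⟨p, q, hp, hq, hpq, hne⟩ := hG a w hw (by simp [← w.length_edges, hwe])
  rw [hws] at hp hq
  rw [hwe] at hne
  simp only [List.mem_cons, List.not_mem_nil, or_false] at hp hq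
  rcases hp with rfl | rfl | rfl | rfl | rfl <;> rcases hq with rfl | rfl | rfl | rfl | rfl <;>
    simp_all [G.adj_comm]

lemma IsChordal.adj_of_fiveCycle (hG : IsChordal G) {a b c d e : V}
    (hC : IsFiveCycle G a b c d e) :
    G.Adj a c ∨ G.Adj b d ∨ G.Adj c e ∨ G.Adj d a ∨ G.Adj e b := by
  obtain ⟨w, hw, hwe, hws⟩ := hC.exists_isCycle
  obtain ⟨p, q, hp, hq, hpq, hne⟩ := hG a w hw (by simp [← w.length_edges, hwe])
  rw [hws] at hp hq
  rw [hwe] at hne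
  simp only [List.mem_cons, List.not_mem_nil, or_false] at hp hq
  rcases hp with rfl | rfl | rfl | rfl | rfl | rfl <;>
    rcases hq with rfl | rfl | rfl | rfl | rfl | rfl <;> simp_all [G.adj_comm]

lemma not_isFiveCycle_of_colorable (hG : G.Colorable 2) {a b c d e : V} :
    ¬ IsFiveCycle G a b c d e := by
  obtain ⟨C⟩ := hG
  intro h
  have h1 := C.valid h.ab
  have h2 := C.valid h.bc
  have h3 := C.valid h.cd
  have h4 := C.valid h.de
  have h5 := C.valid h.ea
  omega

lemma not_triangle_of_colorable (hG : G.Colorable 2) {a b c : V} (hab : G.Adj a b)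
    (hbc : G.Adj b c) : ¬ G.Adj c a := by
  obtain ⟨C⟩ := hG
  intro hca
  have h1 := C.valid hab
  have h2 := C.valid hbc
  have h3 := C.valid hca
  omega

/-- In a cactus, bipartite or chordal graph, a 4-cycle with an edge in a triangle avoiding its
other vertices has a chord. -/
lemma adj_of_triangle_square (hG : IsCactus G ∨ G.Colorable 2 ∨ IsChordal G) {r t t' u w : V}
    (hrt : G.Adj r t) (hrt' : G.Adj r t') (htt' : G.Adj t t') (htu : G.Adj t u) (huw : G.Adj u w)
    (hwt' : G.Adj w t') (hut' : u ≠ t') (hwt : w ≠ t) : G.Adj t w ∨ G.Adj t' u := by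
  rcases hG with hG | hG | hG
  · exact (hG.not_triangle_square htt'.symm hrt.symm hrt' htu huw hwt' hut'.symm hwt.symm).elim
  · exact absurd hrt'.symm (not_triangle_of_colorable hG hrt htt')
  · exact (hG.adj_of_square htu huw hwt' htt'.symm hwt.symm hut').imp_right fun h => h.symm

lemma not_induced_fiveCycle (hG : G.Colorable 2 ∨ IsChordal G) {x t u w t' : V}
    (hC : IsFiveCycle G x t u w t') (hxu : ¬ G.Adj x u) (hxw : ¬ G.Adj x w) (htw : ¬ G.Adj t w)
    (ht'u : ¬ G.Adj t' u) : False := by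
  rcases hG with hG | hG
  · exact not_isFiveCycle_of_colorable hG hC
  · by_cases htt' : G.Adj t' t
    · rcases hG.adj_of_square hC.bc hC.cd hC.de htt' hC.bd hC.ce with h | h
      · exact htw h
      · exact ht'u h.symm
    · rcases hG.adj_of_fiveCycle hC with h | h | h | h | h
      · exact hxu h
      · exact htw h
      · exact ht'u h.symm
      · exact hxw h.symm
      · exact htt' h

end Cycles

section Classes

variable {V : Type} {G : SimpleGraph V} [DecidableEq V] {W : Finset V} {x : V}

lemma IsShedding.not_dominated (hx : IsShedding G W x) (hxW : x ∈ W) {I : Finset V}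
    (hIW : ∀ u ∈ I, u ∈ W ∧ u ≠ x ∧ ¬ G.Adj x u) (hI : indepCpx G I)
    (hdom : ∀ t ∈ W, G.Adj x t → ∃ u ∈ I, G.Adj t u) : False := by
  obtain ⟨y, hyW, hxy, hy⟩ := hx (insert x I)
    ⟨Finset.insert_subset hxW fun u hu => (hIW u hu).1, hI.insert fun z hz => (hIW z hz).2.2⟩
    (Finset.mem_insert_self x I)
  obtain ⟨u, hu, hyu⟩ := hdom y hyW hxy
  exact hy u (Finset.mem_insert_of_mem hu) (hIW u hu).2.1 hyu

lemma IsShedding.exists_dominated_neighbor_of_not_induced_fiveCycle (hx : IsShedding G W x)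
    (hxW : x ∈ W) (hG : G.Colorable 2 ∨ IsChordal G) :
    ∃ y ∈ W, G.Adj x y ∧ ∀ z ∈ W, G.Adj y z → z = x ∨ G.Adj x z := by
  classical
  by_contra! hcon
  have hdom : ∃ I ⊆ W.filter fun u => u ≠ x ∧ ¬ G.Adj x u, indepCpx G I ∧
      ∀ t ∈ W.filter (G.Adj x), ∃ u ∈ I, G.Adj t u := by
    refine exists_indep_dominating _ _ (fun t ht => ?_) fun u hu w hw huw t ht t' ht' htu ht'w => ?_
    · rw [Finset.mem_filter] at ht
      obtain ⟨u, hu, htu, hux, hxu⟩ := hcon t ht.1 ht.2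
      exact ⟨u, by simp [hu, hux, hxu], htu⟩
    · simp only [Finset.mem_filter] at hu hw ht ht'
      by_contra! h
      refine not_induced_fiveCycle hG ⟨ht.2, htu, huw, ht'w.symm, ht'.2.symm, hu.2.1.symm, ?_, ?_,
        hw.2.1, ?_⟩ hu.2.2 hw.2.2 h.1 h.2
      · exact fun e => hw.2.2 (e ▸ ht.2)
      · exact fun e => hu.2.2 (e ▸ ht'.2)
      · exact fun e => h.2 (e ▸ htu)
  obtain ⟨I, hIU, hI, hdom⟩ := hdom
  exact hx.not_dominated hxW (fun u hu => by simpa using hIU hu) hI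
    fun t ht hxt => hdom t (Finset.mem_filter.2 ⟨ht, hxt⟩)

lemma IsShedding.exists_dominated_neighbor_or_fiveCycle_of_isCactus (hx : IsShedding G W x)
    (hxW : x ∈ W) (hG : IsCactus G) :
    (∃ y ∈ W, G.Adj x y ∧ ∀ z ∈ W, G.Adj y z → z = x ∨ G.Adj x z) ∨
      ∃ t ∈ W, ∃ u ∈ W, ∃ w ∈ W, ∃ t' ∈ W, IsFiveCycle G x t u w t' ∧
        (∀ z ∈ W, G.Adj t z → z = x ∨ z = u) ∧ ∀ z ∈ W, G.Adj t' z → z = x ∨ z = w := by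
  classical
  by_contra! hcon
  obtain ⟨hcon, hfive⟩ := hcon
  let Bad : V → V → Prop := fun t u => ∃ w ∈ W, ∃ t' ∈ W, IsFiveCycle G x t u w t'
  have hchoice : ∀ t : V, ∃ u, t ∈ W → G.Adj x t → (u ∈ W ∧ G.Adj t u ∧ u ≠ x ∧ ¬ G.Adj x u) ∧
      (Bad t u → ∀ v ∈ W, G.Adj t v → v ≠ x → ¬ G.Adj x v → Bad t v) := by
    intro t
    by_cases h : ∃ u ∈ W, G.Adj t u ∧ u ≠ x ∧ ¬ G.Adj x u ∧ ¬ Bad t u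
    · obtain ⟨u, hu, htu, hux, hxu, hbad⟩ := h
      exact ⟨u, fun _ _ => ⟨⟨hu, htu, hux, hxu⟩, fun h => absurd h hbad⟩⟩
    · push Not at h
      by_cases ht : t ∈ W ∧ G.Adj x t
      · obtain ⟨u, hu, htu, hux, hxu⟩ := hcon t ht.1 ht.2
        exact ⟨u, fun _ _ => ⟨⟨hu, htu, hux, hxu⟩, fun _ => h⟩⟩
      · exact ⟨t, fun h1 h2 => absurd ⟨h1, h2⟩ ht⟩
  choose f hf using hchoice
  have hnbr : ∀ t ∈ W, ∀ u, ∀ w ∈ W, ∀ t' ∈ W, IsFiveCycle G x t u w t' → u = f t →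
      ∀ z ∈ W, G.Adj t z → z = x ∨ z = u := by
    rintro t ht _ w hw t' ht' hC rfl z hz htz
    by_contra! hzx
    by_cases hxz : G.Adj x z
    · exact hG.not_triangle_fiveCycle hC htz hxz.symm
    · obtain ⟨_, -, _, -, hC'⟩ := (hf t ht hC.ab).2 ⟨w, hw, t', ht', hC⟩ z hz htz hzx.1 hxz
      exact hzx.2 (hG.fiveCycle_unique hC hC')
  have hdom : ∃ I ⊆ (W.filter (G.Adj x)).image f, indepCpx G I ∧
      ∀ t ∈ W.filter (G.Adj x), ∃ u ∈ I, G.Adj t u := by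
    refine exists_indep_dominating _ _ (fun t ht => ⟨f t, Finset.mem_image_of_mem f ht, ?_⟩)
      fun u hu w hw huw t ht t' ht' htu ht'w => ?_
    · rw [Finset.mem_filter] at ht
      exact (hf t ht.1 ht.2).1.2.1
    · obtain ⟨s, hs, rfl⟩ := Finset.mem_image.1 hu
      obtain ⟨s', hs', rfl⟩ := Finset.mem_image.1 hw
      rw [Finset.mem_filter] at ht ht' hs hs'
      obtain ⟨⟨hu1, hu2, hu3, hu4⟩, -⟩ := hf s hs.1 hs.2
      obtain ⟨⟨hw1, hw2, hw3, hw4⟩, -⟩ := hf s' hs'.1 hs'.2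
      by_contra! h
      have hC : IsFiveCycle G x t (f s) (f s') t' := by
        refine ⟨ht.2, htu, huw, ht'w.symm, ht'.2.symm, hu3.symm, ?_, ?_, hw3, ?_⟩
        · exact fun e => hw4 (e ▸ ht.2)
        · exact fun e => hu4 (e ▸ ht'.2)
        · exact fun e => h.2 (e ▸ htu)
      have hC' : IsFiveCycle G x t' (f s') (f s) t := hC.reflect.rotate
      have hts : t = s := by
        by_contra hts
        exact hG.not_square_fiveCycle hC htu hu2.symm hs.2.symm hu3.symm hts
      have hts' : t' = s' := by
        by_contra hts
        exact hG.not_square_fiveCycle hC' ht'w hw2.symm hs'.2.symm hw3.symm hts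
      obtain ⟨z, hz, htz, hzx, hzw⟩ := hfive t ht.1 _ hu1 _ hw1 t' ht'.1 hC
        (hnbr t ht.1 _ _ hw1 t' ht'.1 hC (by rw [hts]))
      rcases hnbr t' ht'.1 _ _ hu1 t ht.1 hC' (by rw [hts']) z hz htz with h | h
      · exact hzx h
      · exact hzw h
  obtain ⟨I, hIU, hI, hdom⟩ := hdom
  refine hx.not_dominated hxW (fun u hu => ?_) hI
    fun t ht hxt => hdom t (Finset.mem_filter.2 ⟨ht, hxt⟩)
  obtain ⟨t, ht, rfl⟩ := Finset.mem_image.1 (hIU hu)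
  rw [Finset.mem_filter] at ht
  obtain ⟨⟨h1, -, h2, h3⟩, -⟩ := hf t ht.1 ht.2
  exact ⟨h1, h2, h3⟩

variable [Fintype V]

lemma exists_blockFunction (hG : IsCactus G ∨ G.Colorable 2 ∨ IsChordal G)
    {Δ : Finset V → Prop} (hΔ : VertexDecomposable Δ) :
    ∀ W : Finset V, Δ = indepCpxOn G W → IsPure Δ → ∃ f, IsBlockFunction G W f := by
  induction hΔ with
  | simplex Δ F h =>
    rintro W rfl -
    have hW : indepCpxOn G W W := by
      have hWF : W ⊆ F := fun v hv => (h {v}).1 (indepCpxOn_singleton hv) (by simp)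
      exact (h W).2 hWF
    refine ⟨fun v => Fintype.equivFin V v, fun v hv => Or.inl ⟨?_, fun A hA => ?_, Or.inr ?_⟩⟩
    · intro u _ w _ hu hw huw
      exact absurd ((Fintype.equivFin V).injective (Fin.ext (hu.trans hw.symm))) huw
    · exact ⟨v, hA.2 W hW hA.1.1 ▸ hv, rfl⟩
    · exact ⟨v, hv, rfl, fun z hz hzv => absurd hzv (hW.2 z hz v hv)⟩
  | shed Δ x hx _ _ hshed _ ih =>
    rintro W rfl hpure
    have hxW : x ∈ W := hx.1 (Finset.mem_singleton_self x)
    have hsh := isShedding_of_facets hshed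
    obtain ⟨f, hf⟩ := ih (W.erase x) cplxDel_indepCpxOn (by
      rw [cplxDel_indepCpxOn]
      exact fun A B hA hB =>
        hpure A B (hsh.isFacet_of_isFacet_erase hA) (hsh.isFacet_of_isFacet_erase hB))
    have hcases : (∃ y ∈ W, G.Adj x y ∧ ∀ z ∈ W, G.Adj y z → z = x ∨ G.Adj x z) ∨
        (IsCactus G ∧ ∃ t ∈ W, ∃ u ∈ W, ∃ w ∈ W, ∃ t' ∈ W, IsFiveCycle G x t u w t' ∧
          (∀ z ∈ W, G.Adj t z → z = x ∨ z = u) ∧ ∀ z ∈ W, G.Adj t' z → z = x ∨ z = w) := by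
      rcases hG with hG | hG
      · exact (hsh.exists_dominated_neighbor_or_fiveCycle_of_isCactus hxW hG).imp_right (⟨hG, ·⟩)
      · exact Or.inl (hsh.exists_dominated_neighbor_of_not_induced_fiveCycle hxW hG)
    rcases hcases with ⟨y, hyW, hxy, hdom⟩ |
      ⟨hG, t, ht, u, hu, w, hw, t', ht', hC, hnt, hnt'⟩
    · have hyW' : y ∈ W.erase x := Finset.mem_erase.2 ⟨hxy.ne', hyW⟩
      rcases hf y hyW' with hy | ⟨hcact, ⟨a, b, c, d, e, hC, hfib⟩, -⟩
      · exact exists_blockFunction_of_cliqueBlock hxW hpure hsh hf hyW hxy hdom hy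
      · have hadj : ∀ v, (v = a ∨ v = b ∨ v = c ∨ v = d ∨ v = e) → G.Adj y v → G.Adj x v := by
          intro v hv hyv
          have hvW := ((hfib v).2 hv).1
          exact (hdom v (Finset.mem_of_mem_erase hvW) hyv).resolve_left
            (Finset.ne_of_mem_erase hvW)
        have hy := (hfib y).1 ⟨hyW', rfl⟩
        obtain ⟨p, hp, hyp, -⟩ := hC.exists_ne_adj (z := x) hy
        obtain ⟨r, hr, hyr, hrp⟩ := hC.exists_ne_adj (z := p) hy
        exact absurd (hcact.triangle_unique hxy hyr (hadj r hr hyr).symm hyp (hadj p hp hyp).symm)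
          hrp
    · exact exists_blockFunction_of_fiveCycle hG hxW hpure hsh hf hC ht hu hw ht' hnt hnt'

end Classes

section BlockExchange

variable {V : Type} {G : SimpleGraph V} [DecidableEq V] [Fintype V] {f : V → ℕ} {i : ℕ}

/-- For every order that lists the blocks of `f` one after the other and, inside the block `i`,
the vertices satisfying a suitable predicate last, facets of the independence complex can be
exchanged at the vertices of the block `i`. -/
def HasBlockExchange (G : SimpleGraph V) (f : V → ℕ) (i : ℕ) : Prop :=
  ∃ L : V → Prop, ∀ r : LinearOrder V, (∀ p q, f p < f q → r.lt p q) →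
    (∀ p q, f p = i → f q = i → ¬ L p → L q → r.lt p q) →
    ∀ A B, IsFacet (indepCpxOn G Finset.univ) A → IsFacet (indepCpxOn G Finset.univ) B →
      ∀ q, f q = i → (∀ p, r.lt p q → (p ∈ A ↔ p ∈ B)) → q ∈ A → q ∉ B →
        ∃ p, r.lt q p ∧ p ∉ A ∧ IsFacet (indepCpxOn G Finset.univ) (insert p (A.erase q))

lemma IsCliqueBlock.exists_last (hG : IsCactus G ∨ G.Colorable 2 ∨ IsChordal G)
    (h : IsCliqueBlock G Finset.univ f i) :
    ∃ s, f s = i ∧ (∀ z, G.Adj z s → f z ≤ i) ∧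
      ((∀ z, G.Adj z s → f z = i) ∨ (Finset.univ.filter (f · = i)).card ≤ 2) := by
  obtain ⟨hcl, hhit, hcard⟩ := h
  simp only [Finset.mem_univ, true_imp_iff, true_and] at hcl hcard
  by_cases h3 : (Finset.univ.filter (f · = i)).card ≤ 2
  · obtain ⟨y, hy, hmax⟩ := hcard.resolve_left (by omega)
    exact ⟨y, hy, hmax, Or.inr h3⟩
  · suffices ∃ s, f s = i ∧ ∀ z, G.Adj z s → f z = i by
      obtain ⟨s, hs, hsz⟩ := this
      exact ⟨s, hs, fun z hz => (hsz z hz).le, Or.inl hsz⟩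
    by_contra! hcon
    have hdom : ∃ I ⊆ Finset.univ.filter (f · ≠ i), indepCpx G I ∧
        ∀ t ∈ Finset.univ.filter (f · = i), ∃ u ∈ I, G.Adj t u := by
      refine exists_indep_dominating _ _ (fun t ht => ?_)
        fun u hu w hw huw t ht t' ht' htu ht'w => ?_
      · obtain ⟨z, hz, hfz⟩ := hcon t (by simpa using ht)
        exact ⟨z, by simpa using hfz, hz.symm⟩
      · by_cases htt' : t = t'
        · exact Or.inl (htt' ▸ ht'w)
        have hr : ∃ r ∈ Finset.univ.filter (f · = i), r ∉ ({t, t'} : Finset V) :=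
          Finset.exists_mem_notMem_of_card_lt_card
            ((Finset.card_le_two (a := t) (b := t')).trans_lt (not_le.1 h3))
        obtain ⟨r, hr, hrt⟩ := hr
        simp only [Finset.mem_filter, Finset.mem_univ, true_and, Finset.mem_insert,
          Finset.mem_singleton, not_or] at hr hrt hu hw ht ht'
        exact adj_of_triangle_square hG (hcl r t hr ht hrt.1) (hcl r t' hr ht' hrt.2)
          (hcl t t' ht ht' htt') htu huw ht'w.symm (fun e => hu (e ▸ ht')) fun e => hw (e ▸ ht)
    obtain ⟨I, -, hI, hdom⟩ := hdom
    obtain ⟨B, hB, hIB⟩ := exists_facet_of_face (Δ := indepCpxOn G Finset.univ) (F := I)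
      ⟨Finset.subset_univ _, hI⟩
    obtain ⟨p, hp, hfp⟩ := hhit B hB
    obtain ⟨u, hu, hpu⟩ := hdom p (by simpa using hfp)
    exact hB.1.2 p hp u (hIB hu) hpu

lemma IsCliqueBlock.hasBlockExchange (hG : IsCactus G ∨ G.Colorable 2 ∨ IsChordal G)
    (hpure : IsPure (indepCpxOn G Finset.univ)) (h : IsCliqueBlock G Finset.univ f i) :
    HasBlockExchange G f i := by
  obtain ⟨s, hs, hmax, hs'⟩ := h.exists_last hG
  obtain ⟨hcl, hhit, -⟩ := h
  simp only [Finset.mem_univ, true_imp_iff] at hcl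
  refine ⟨(· = s), fun r hrf hrL A B hA hB q hq hAB hqA hqB => ?_⟩
  obtain ⟨p, hpB, hp⟩ := hhit B hB
  have hpq : p ≠ q := fun e => hqB (e ▸ hpB)
  by_cases hqs : q = s
  · subst hqs
    exact absurd (hcl p q hp hq hpq) (hA.1.2 p ((hAB p (hrL p q hp hq hpq rfl)).2 hpB) q hqA)
  have hqs' := hcl q s hq hs hqs
  have hsA : s ∉ A := fun h => hA.1.2 q hqA s h hqs'
  refine ⟨s, hrL q s hq hs hqs rfl, hsA,
    isFacet_exchange hpure hA hqA hsA (Finset.mem_univ s) fun z hz hzq hsz => ?_⟩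
  rcases (hmax z hsz.symm).eq_or_lt with hfz | hfz
  · exact hA.1.2 z hz q hqA (hcl z q hfz hq hzq)
  · have hzB : z ∈ B := (hAB z (hrf z q (hq ▸ hfz))).1 hz
    have hcard := hs'.resolve_left fun h => hfz.ne (h z hsz.symm)
    have hps : p = s := by
      by_contra hps
      have hsub : ({p, q, s} : Finset V) ⊆ Finset.univ.filter (f · = i) := by
        intro v hv
        simp only [Finset.mem_insert, Finset.mem_singleton] at hv
        rcases hv with rfl | rfl | rfl <;> simpa
      have h3 : ({p, q, s} : Finset V).card = 3 :=
        Finset.card_eq_three.2 ⟨p, q, s, hpq, hps, hqs, rfl⟩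
      have := Finset.card_le_card hsub
      omega
    exact hB.1.2 s (hps ▸ hpB) z hzB hsz

lemma IsCactus.neighbors_of_fiveCycle (hG : IsCactus G) {a b c d e : V}
    (hC : IsFiveCycle G a b c d e)
    (hfib : ∀ v, f v = i ↔ v = a ∨ v = b ∨ v = c ∨ v = d ∨ v = e)
    (hhit : ∀ A, IsFacet (indepCpxOn G Finset.univ) A →
      ∃ p ∈ A, ∃ r ∈ A, p ≠ r ∧ f p = i ∧ f r = i) :
    (∀ z, G.Adj a z → z = b ∨ z = e) ∨ ∀ z, G.Adj b z → z = c ∨ z = a := by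
  by_contra! hcon
  obtain ⟨⟨z, haz, hzb, hze⟩, z', hbz', hz'c, hz'a⟩ := hcon
  have hC2 : IsFiveCycle G b c d e a := hC.rotate
  have hC4 : IsFiveCycle G d e a b c := hC2.rotate.rotate
  have hC5 : IsFiveCycle G e a b c d := hC4.rotate
  have hbz : ¬ G.Adj b z := fun h => hG.not_triangle_fiveCycle hC h haz.symm
  have hdz : ¬ G.Adj d z := fun h =>
    hG.not_square_fiveCycle hC4.rotate haz h.symm hC.de (Ne.symm hze) hC.da.symm
  have hdz' : ¬ G.Adj d z' := fun h =>
    hG.not_square_fiveCycle hC2 hC.cd h hbz'.symm hC.bd (Ne.symm hz'c)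
  have hzz' : ¬ G.Adj z z' := fun h =>
    hG.not_square_fiveCycle hC hbz' h.symm haz.symm (Ne.symm hz'a) (Ne.symm hzb)
  obtain ⟨A, hA, hsub⟩ := exists_facet_of_face (Δ := indepCpxOn G Finset.univ)
    (F := {d, z, z'}) ⟨Finset.subset_univ _,
      ((indepCpx_singleton z').insert (by simpa using hzz')).insert (by simp [hdz, hdz'])⟩
  have hdA : d ∈ A := hsub (by simp)
  have hzA : z ∈ A := hsub (by simp)
  have hz'A : z' ∈ A := hsub (by simp)
  have hind := hA.1.2
  have hkey : ∀ p ∈ A, (p = a ∨ p = b ∨ p = c ∨ p = d ∨ p = e) → p = d := by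
    rintro p hp (rfl | rfl | rfl | rfl | rfl)
    · exact absurd haz (hind _ hp _ hzA)
    · exact absurd hbz' (hind _ hp _ hz'A)
    · exact absurd hC.cd (hind _ hp _ hdA)
    · rfl
    · exact absurd hC.de (hind _ hdA _ hp)
  obtain ⟨p, hp, r, hr, hpr, hpC, hrC⟩ := hhit A hA
  exact hpr ((hkey p hp ((hfib p).1 hpC)).trans (hkey r hr ((hfib r).1 hrC)).symm)

lemma hasBlockExchange_of_fiveCycle (hpure : IsPure (indepCpxOn G Finset.univ)) {a b c d e : V}
    (hC : IsFiveCycle G a b c d e)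
    (hfib : ∀ v, f v = i ↔ v = a ∨ v = b ∨ v = c ∨ v = d ∨ v = e)
    (hhit : ∀ A, IsFacet (indepCpxOn G Finset.univ) A →
      ∃ p ∈ A, ∃ r ∈ A, p ≠ r ∧ f p = i ∧ f r = i)
    (hb : ∀ z, G.Adj b z → z = c ∨ z = a) (hd : ∀ z, G.Adj d z → z = e ∨ z = c)
    (he : ∀ z, G.Adj e z → z = a ∨ z = d) : HasBlockExchange G f i := by
  refine ⟨fun v => v = b ∨ v = d ∨ v = e, fun r hrf hrL A B hA hB q hq hAB hqA hqB => ?_⟩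
  have hAi := hA.1.2
  have hBi := hB.1.2
  obtain ⟨hab, hbc, hcd, hde, hea, hac, hbd, hce, hda, heb⟩ := hC
  have hlt : ∀ p, p = a ∨ p = c → ∀ q, q = b ∨ q = d ∨ q = e → r.lt p q := by
    intro p hp q hq
    refine hrL p q ((hfib p).2 ?_) ((hfib q).2 ?_) ?_ hq
    · tauto
    · tauto
    · have := hab.ne
      have := hbc.ne
      have := hcd.ne
      have := hea.ne
      rcases hp with rfl | rfl <;> simp only [not_or] <;> refine ⟨?_, ?_, ?_⟩ <;> tauto
  have hex : ∀ p, r.lt q p → p ∉ A → (∀ z ∈ A, z ≠ q → ¬ G.Adj p z) → ∃ p, r.lt q p ∧ p ∉ A ∧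
      IsFacet (indepCpxOn G Finset.univ) (insert p (A.erase q)) := fun p hqp hpA hadj =>
    ⟨p, hqp, hpA, isFacet_exchange hpure hA hqA hpA (Finset.mem_univ p) hadj⟩
  obtain ⟨p, hp, s, hs, hps, hpC, hsC⟩ := hhit B hB
  rw [hfib] at hpC hsC
  rcases (hfib q).1 hq with rfl | rfl | rfl | rfl | rfl
  · by_cases hcA : c ∈ A
    · refine hex e (hlt _ (by simp) _ (by simp)) (fun h => hAi _ h _ hqA hea) fun z hz hzq hez => ?_
      rcases he z hez with rfl | rfl
      · exact hzq rfl
      · exact hAi _ hcA _ hz hcd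
    · refine hex b (hlt _ (by simp) _ (by simp)) (fun h => hAi _ hqA _ h hab) fun z hz hzq hbz => ?_
      rcases hb z hbz with rfl | rfl
      · exact hcA hz
      · exact hzq rfl
  · have haA : a ∉ A := fun h => hAi _ h _ hqA hab
    have hcA : c ∉ A := fun h => hAi _ hqA _ h hbc
    rw [hAB a (hlt _ (by simp) _ (by simp))] at haA
    rw [hAB c (hlt _ (by simp) _ (by simp))] at hcA
    have h1 := hBi p hp s hs
    have h2 := hBi s hs p hp
    rcases hpC with rfl | rfl | rfl | rfl | rfl <;> rcases hsC with rfl | rfl | rfl | rfl | rfl <;>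
      tauto
  · by_cases haA : a ∈ A
    · refine hex d (hlt _ (by simp) _ (by simp)) (fun h => hAi _ hqA _ h hcd) fun z hz hzq hdz => ?_
      rcases hd z hdz with rfl | rfl
      · exact hAi _ hz _ haA hea
      · exact hzq rfl
    · refine hex b (hlt _ (by simp) _ (by simp)) (fun h => hAi _ h _ hqA hbc) fun z hz hzq hbz => ?_
      rcases hb z hbz with rfl | rfl
      · exact hzq rfl
      · exact haA hz
  · have hcA : c ∉ A := fun h => hAi _ h _ hqA hcd
    have heA : e ∉ A := fun h => hAi _ hqA _ h hde
    have hcB := hcA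
    rw [hAB c (hlt _ (by simp) _ (by simp))] at hcB
    have hbe : b ∈ B ∧ e ∈ B := by
      have h1 := hBi p hp s hs
      have h2 := hBi s hs p hp
      rcases hpC with rfl | rfl | rfl | rfl | rfl <;>
        rcases hsC with rfl | rfl | rfl | rfl | rfl <;> tauto
    have haA : a ∉ A := fun h =>
      hBi _ hbe.2 _ ((hAB a (hlt _ (by simp) _ (by simp))).1 h) hea
    have hqe : r.lt q e := by
      rcases @lt_trichotomy V r q e with h | h | h
      · exact h
      · exact absurd h hde.ne
      · exact absurd ((hAB e h).2 hbe.2) heA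
    refine hex e hqe heA fun z hz hzq hez => ?_
    rcases he z hez with rfl | rfl
    · exact haA hz
    · exact hzq rfl
  · have haA : a ∉ A := fun h => hAi _ hqA _ h hea
    have hdA : d ∉ A := fun h => hAi _ h _ hqA hde
    have haB := haA
    rw [hAB a (hlt _ (by simp) _ (by simp))] at haB
    have hbd' : b ∈ B ∧ d ∈ B := by
      have h1 := hBi p hp s hs
      have h2 := hBi s hs p hp
      rcases hpC with rfl | rfl | rfl | rfl | rfl <;>
        rcases hsC with rfl | rfl | rfl | rfl | rfl <;> tauto
    have hcA : c ∉ A := fun h =>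
      hBi _ hbd'.1 _ ((hAB c (hlt _ (by simp) _ (by simp))).1 h) hbc
    have hqd : r.lt q d := by
      rcases @lt_trichotomy V r q d with h | h | h
      · exact h
      · exact absurd h.symm hde.ne
      · exact absurd ((hAB d h).2 hbd'.2) hdA
    refine hex d hqd hdA fun z hz hzq hdz => ?_
    rcases hd z hdz with rfl | rfl
    · exact hzq rfl
    · exact hcA hz

lemma IsFiveBlock.hasBlockExchange (hG : IsCactus G) (hpure : IsPure (indepCpxOn G Finset.univ))
    (h : IsFiveBlock G Finset.univ f i) : HasBlockExchange G f i := by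
  obtain ⟨⟨a, b, c, d, e, hC, hfib⟩, hhit⟩ := h
  simp only [Finset.mem_univ, true_and] at hfib
  have hfib' : ∀ {a b c d e : V}, (∀ v, f v = i ↔ v = a ∨ v = b ∨ v = c ∨ v = d ∨ v = e) →
      ∀ v, f v = i ↔ v = b ∨ v = c ∨ v = d ∨ v = e ∨ v = a := by
    intro a b c d e h v
    rw [h]
    tauto
  have hC₂ := hC.rotate
  have hC₃ := hC₂.rotate
  have hC₄ := hC₃.rotate
  have hC₅ := hC₄.rotate
  have hfib₂ := hfib' hfib
  have hfib₃ := hfib' hfib₂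
  have hfib₄ := hfib' hfib₃
  have hfib₅ := hfib' hfib₄
  have e₁ := hasBlockExchange_of_fiveCycle hpure hC hfib hhit
  have e₂ := hasBlockExchange_of_fiveCycle hpure hC₂ hfib₂ hhit
  have e₃ := hasBlockExchange_of_fiveCycle hpure hC₃ hfib₃ hhit
  have e₄ := hasBlockExchange_of_fiveCycle hpure hC₄ hfib₄ hhit
  have e₅ := hasBlockExchange_of_fiveCycle hpure hC₅ hfib₅ hhit
  have n₁ := hG.neighbors_of_fiveCycle hC hfib hhit
  have n₂ := hG.neighbors_of_fiveCycle hC₂ hfib₂ hhit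
  have n₃ := hG.neighbors_of_fiveCycle hC₃ hfib₃ hhit
  have n₄ := hG.neighbors_of_fiveCycle hC₄ hfib₄ hhit
  have n₅ := hG.neighbors_of_fiveCycle hC₅ hfib₅ hhit
  rcases n₁ with ha | hb
  · rcases n₂ with hb | hc
    · rcases n₃ with hc | hd
      · rcases n₄ with hd | he
        · exact e₅ ha hc hd
        · exact e₂ hc he ha
      · exact e₃ hd ha hb
    · rcases n₄ with hd | he
      · exact e₅ ha hc hd
      · exact e₂ hc he ha
  · rcases n₃ with hc | hd
    · rcases n₄ with hd | he
      · rcases n₅ with he | ha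
        · exact e₁ hb hd he
        · exact e₅ ha hc hd
      · exact e₄ he hb hc
    · rcases n₅ with he | ha
      · exact e₁ hb hd he
      · exact e₃ hd ha hb

lemma IsBlockFunction.exists_facetExchange (hG : IsCactus G ∨ G.Colorable 2 ∨ IsChordal G)
    (hpure : IsPure (indepCpxOn G Finset.univ)) (hf : IsBlockFunction G Finset.univ f) :
    ∃ r : LinearOrder V, FacetExchange r.lt (indepCpxOn G Finset.univ) := by
  classical
  have hex : ∀ i, HasBlockExchange G f i := by
    intro i
    by_cases hi : ∃ v, f v = i
    · obtain ⟨v, rfl⟩ := hi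
      rcases hf v (Finset.mem_univ v) with h | ⟨hG', h⟩
      · exact h.hasBlockExchange hG hpure
      · exact h.hasBlockExchange hG' hpure
    · exact ⟨fun _ => False, fun r _ _ A B _ _ q hq => absurd ⟨q, hq⟩ hi⟩
  choose L hL using hex
  let key : V → ℕ ×ₗ ℕ ×ₗ ℕ := fun v =>
    toLex (f v, toLex ((if L (f v) v then 1 else 0 : ℕ), (Fintype.equivFin V v : ℕ)))
  have hinj : Function.Injective key := fun v w h => by
    have h' := congrArg (fun k => (ofLex (ofLex k).2).2) h
    exact (Fintype.equivFin V).injective (Fin.ext h')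
  let r : LinearOrder V := LinearOrder.lift' key hinj
  have hr : ∀ p q, r.lt p q ↔ key p < key q := fun p q => Iff.rfl
  refine ⟨r, fun A B hA hB q hAB hqA hqB => hL (f q) r (fun p q hpq => ?_)
    (fun p q hp hq hpL hqL => ?_) A B hA hB q rfl hAB hqA hqB⟩
  · rw [hr, Prod.Lex.toLex_lt_toLex]
    exact Or.inl hpq
  · rw [hr, Prod.Lex.toLex_lt_toLex]
    refine Or.inr ⟨hp.trans hq.symm, ?_⟩
    simp only [Prod.Lex.toLex_lt_toLex]
    left
    rw [hp, hq, if_neg hpL, if_pos hqL]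
    exact Nat.zero_lt_one

end BlockExchange

theorem dualIdeal_weaklyPolymatroidal_iff_vertexDecomposable_and_pure
    (V : Type) [Fintype V] [DecidableEq V] (G : SimpleGraph V)
    (hclass : IsCactus G ∨ G.Colorable 2 ∨ IsChordal G) :
    (∃ r : LinearOrder V, WeaklyPolymatroidalWrt K r.lt (dualIdeal K (indepCpx G))) ↔
      (VertexDecomposable (indepCpx G) ∧ IsPure (indepCpx G)) := by
  simp only [weaklyPolymatroidalWrt_dualIdeal_iff]
  constructor
  · rintro ⟨r, h⟩
    exact h.vertexDecomposable_and_isPure r _ _ (fun F F' hF hF' => hF.mono hF')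
      (by simp [indepCpx]) le_rfl
  · rintro ⟨hvd, hpure⟩
    obtain ⟨f, hf⟩ := exists_blockFunction hclass hvd Finset.univ indepCpxOn_univ.symm hpure
    rw [← indepCpxOn_univ] at hpure ⊢
    exact hf.exists_facetExchange hclass hpure

end Stmt
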